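/- arXiv:2202.11517 — 4 statements merged into one kernel-verified Lean document; each statement's English description precedes it below -/
import Mathlib

section
/- Let f be a homeomorphism of the open annulus A = (ℝ/ℤ) × (0,1) that is isotopic to the identity, preserves a finite area, and is reversible. Let k, n₀ ≥ 1 be integers with gcd(k, n₀) = 1. If f has a point z with f^[k](z) = z, then the set of symmetric periodic points of f whose minimal period is a positive integer coprime to n₀ is infinite. -/
open MeasureTheory Filter Topology

/-- The circle `ℝ/ℤ`. -/
abbrev Circle1 : Type := AddCircle (1 : ℝ)

/-- The open annulus `(ℝ/ℤ) × (0,1)`. -/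
abbrev AnnO : Type := Circle1 × ↥(Set.Ioo (0 : ℝ) 1)

/-- The reflection `R(θ, y) = (−θ, y)` of the open annulus. -/
noncomputable def RO : AnnO → AnnO := fun z => (-z.1, z.2)

/-- `f` is isotopic to the identity. -/
def IsotopicToIdO (f : AnnO → AnnO) : Prop :=
  ∃ H : ↥(Set.Icc (0 : ℝ) 1) × AnnO → AnnO, Continuous H ∧
    (∀ z, H (⟨0, by norm_num⟩, z) = z) ∧
    (∀ z, H (⟨1, by norm_num⟩, z) = f z) ∧
    (∀ t, ∃ g : AnnO ≃ₜ AnnO, ∀ z, H (t, z) = g z)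

/-- `f` preserves a finite area: a finite Borel measure, without atoms,
positive on nonempty open sets. -/
def PreservesFiniteAreaO (f : AnnO → AnnO) : Prop :=
  ∃ μ : Measure AnnO, μ Set.univ < ⊤ ∧ (∀ z, μ {z} = 0) ∧
    (∀ U : Set AnnO, IsOpen U → U.Nonempty → 0 < μ U) ∧
    MeasurePreserving f μ μ

open Complex in
lemma exists_log_lift {X : Type*} [TopologicalSpace X] [ContractibleSpace X]
    [LocallyPathConnectedSpace X] (φ : X → ℂ) (hc : Continuous φ) (h0 : ∀ x, φ x ≠ 0) :
    ∃ L : X → ℂ, Continuous L ∧ ∀ x, Complex.exp (L x) = φ x := by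
  have a₀ : X := Classical.arbitrary X
  obtain ⟨F, ⟨-, hF⟩, -⟩ := Complex.isCoveringMapOn_exp.existsUnique_continuousMap_lifts
    (⟨φ, hc⟩ : C(X, ℂ)) (a₀ := a₀) (e₀ := Complex.log (φ a₀))
    (by simp [Complex.exp_log (h0 a₀)]) (by simpa using h0)
  exact ⟨F, F.continuous, fun x => congrFun hF x⟩

lemma log_lift_unique {X : Type*} [TopologicalSpace X] [PreconnectedSpace X] [Nonempty X]
    (L L' : X → ℂ) (hL : Continuous L) (hL' : Continuous L')
    (h : ∀ x, Complex.exp (L x) = Complex.exp (L' x)) :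
    ∃ n : ℤ, ∀ x, L x = L' x + n * (2 * Real.pi * Complex.I) := by
  have a₀ : X := Classical.arbitrary X
  obtain ⟨n, hn⟩ := Complex.exp_eq_exp_iff_exists_int.1 (h a₀)
  refine ⟨n, fun x => ?_⟩
  refine congrFun (Complex.isCoveringMap_exp.eq_of_comp_eq hL
    (g₂ := fun x => L' x + n * (2 * Real.pi * Complex.I)) (by fun_prop) ?_ a₀ hn) x
  funext y
  apply Subtype.ext
  simp only [Function.comp]
  rw [h y, Complex.exp_add, Complex.exp_int_mul_two_pi_mul_I, mul_one]

open ComplexConjugate in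
lemma lemmaA (Γ : ℝ → ℂ → ℂ) (hc : Continuous (fun p : ℝ × ℂ => Γ p.1 p.2))
    (inj : ∀ t, Function.Injective (Γ t)) (h0 : ∀ z, Γ 0 z = z)
    (hinv : ∀ z, Γ 1 (conj (Γ 1 (conj z))) = z) (nofix : ∀ s : ℝ, Γ 1 s ≠ s) (s : ℝ) :
    (Γ 1 s).im ≠ 0 := by
  intro him
  obtain ⟨t, ht⟩ : ∃ t : ℝ, Γ 1 s = t := ⟨(Γ 1 s).re, by apply Complex.ext <;> simp [him]⟩
  have hinv' : ∀ r : ℝ, Γ 1 (conj (Γ 1 r)) = r := fun r => by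
    have := hinv r; rwa [Complex.conj_ofReal] at this
  have hts : Γ 1 t = s := by
    have := hinv' s
    rwa [ht, Complex.conj_ofReal] at this
  have hcs : Continuous (fun z => Γ 1 z) := hc.comp (by fun_prop : Continuous fun z : ℂ => ((1:ℝ), z))
  -- the path and the displacement
  set r : ℝ → ℝ := fun σ => s + σ * (t - s) with hr
  have hrc : Continuous r := by fun_prop
  set W : ℝ → ℂ := fun σ => Γ 1 (r σ) - r σ with hW
  have hWc : Continuous W := by
    apply Continuous.sub
    · exact hcs.comp (by fun_prop)
    · fun_prop
  have hW0 : ∀ σ, W σ ≠ 0 := fun σ => sub_ne_zero.2 (nofix _)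
  set Φ : ℝ × ℝ → ℂ := fun p =>
    (Γ p.1 (conj (Γ 1 (r p.2))) - Γ p.1 (r p.2)) / conj (W p.2) with hΦ
  have hΦc : Continuous Φ := by
    apply Continuous.div
    · apply Continuous.sub
      · refine hc.comp (Continuous.prodMk continuous_fst ?_)
        exact Complex.continuous_conj.comp (hcs.comp (Complex.continuous_ofReal.comp (hrc.comp continuous_snd)))
      · exact hc.comp (Continuous.prodMk continuous_fst
          (Complex.continuous_ofReal.comp (hrc.comp continuous_snd)))
    · exact Complex.continuous_conj.comp (hWc.comp continuous_snd)
    · intro p; simpa using hW0 p.2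
  have hΦ0 : ∀ p, Φ p ≠ 0 := by
    intro p
    apply div_ne_zero
    · rw [sub_ne_zero]
      intro h
      have h1 := inj _ h
      have h2 := congrArg conj h1
      rw [Complex.conj_conj, Complex.conj_ofReal] at h2
      exact nofix _ h2
    · simpa using hW0 p.2
  obtain ⟨L, hLc, hL⟩ := exists_log_lift Φ hΦc hΦ0
  have hr0 : r 0 = s := by simp [hr]
  have hr1 : r 1 = t := by simp [hr]
  have hst : (t : ℂ) - s ≠ 0 := by
    have := hW0 0
    simpa [hW, hr0, ht] using this
  have hst' : (s : ℂ) - t ≠ 0 := by rw [← neg_sub]; exact neg_ne_zero.2 hst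
  have hends : ∀ τ, Φ (τ, 1) = Φ (τ, 0) := by
    intro τ
    simp only [hΦ, hW, hr0, hr1, ht, hts, map_sub, Complex.conj_ofReal]
    field_simp
    ring
  obtain ⟨n, hn⟩ := log_lift_unique (fun τ : ℝ => L (τ, 1)) (fun τ => L (τ, 0))
    (by fun_prop) (by fun_prop) (fun τ => by rw [hL, hL, hends])
  have hone : ∀ σ, Φ (0, σ) = 1 := by
    intro σ
    simp only [hΦ, h0, hW, map_sub, Complex.conj_ofReal]
    apply div_self
    have := hW0 σ
    rw [← map_ne_zero (starRingEnd ℂ)] at this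
    simpa [hW] using this
  obtain ⟨m, hm⟩ := log_lift_unique (fun σ : ℝ => L (0, σ)) (fun _ => 0)
    (by fun_prop) (by fun_prop) (fun σ => by rw [hL, hone, Complex.exp_zero])
  have hn0 : (n : ℂ) * (2 * Real.pi * Complex.I) = 0 := by
    have h1 := hn 0
    have h2 := hm 0
    have h3 := hm 1
    rw [h2, h3] at h1
    simpa using h1
  have hL1 : L (1, 1) = L (1, 0) := by have := hn 1; rw [hn0, add_zero] at this; exact this
  -- half
  have hsq : ∀ σ, Complex.exp (L (1, σ)) * conj (W σ) = - W σ := by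
    intro σ
    rw [hL]
    simp only [hΦ]
    rw [div_mul_cancel₀ _ (by simpa using hW0 σ), hinv']
    simp [hW]
  have hnorm : ∀ σ, ‖Complex.exp (L (1, σ) / 2)‖ = 1 := by
    intro σ
    have h1 := congrArg norm (hsq σ)
    rw [norm_mul, RCLike.norm_conj, norm_neg] at h1
    have h2 : ‖Complex.exp (L (1, σ))‖ = 1 := by
      have := norm_ne_zero_iff.2 (hW0 σ)
      field_simp at h1
      exact h1
    rw [Complex.norm_exp] at h2 ⊢
    rw [Real.exp_eq_one_iff] at h2 ⊢
    simp [h2]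
  set h : ℝ → ℂ := fun σ => Complex.exp (L (1, σ) / 2) * conj (W σ) with hh
  have hconj : ∀ σ, conj (h σ) = - h σ := by
    intro σ
    have h1 : conj (Complex.exp (L (1, σ) / 2)) * Complex.exp (L (1, σ) / 2) = 1 := by
      rw [mul_comm, Complex.mul_conj, Complex.normSq_eq_norm_sq, hnorm]; simp
    have h2 : Complex.exp (L (1, σ)) = Complex.exp (L (1, σ) / 2) * Complex.exp (L (1, σ) / 2) := by
      rw [← Complex.exp_add]; congr 1; ring
    have h3 := hsq σ
    rw [h2] at h3
    simp only [hh, map_mul, Complex.conj_conj]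
    have h4 : W σ = - (Complex.exp (L (1, σ) / 2) * Complex.exp (L (1, σ) / 2) * conj (W σ)) := by
      rw [h3]; ring
    rw [show conj (Complex.exp (L (1, σ) / 2)) * W σ = conj (Complex.exp (L (1, σ) / 2)) *
      (- (Complex.exp (L (1, σ) / 2) * Complex.exp (L (1, σ) / 2) * conj (W σ))) by rw [← h4]]
    linear_combination (-(Complex.exp (L (1, σ) / 2) * conj (W σ))) * h1
  have hre : ∀ σ, (h σ).re = 0 := by
    intro σ
    have := congrArg Complex.re (hconj σ)
    simp at this
    linarith
  have hne : ∀ σ, h σ ≠ 0 := fun σ => mul_ne_zero (Complex.exp_ne_zero _) (by simpa using hW0 σ)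
  have himne : ∀ σ, (h σ).im ≠ 0 := fun σ hi => hne σ (Complex.ext (hre σ) hi)
  have hhc : Continuous fun σ => (h σ).im := by
    apply Complex.continuous_im.comp
    apply Continuous.mul
    · apply Complex.continuous_exp.comp
      exact (hLc.comp (by fun_prop)).div_const 2
    · exact Complex.continuous_conj.comp hWc
  have hflip : (h 1).im = - (h 0).im := by
    rw [← Complex.neg_im]
    congr 1
    simp only [hh, hL1, hW, hr0, hr1, ht, hts, map_sub, Complex.conj_ofReal]
    ring
  have hzero : (0 : ℝ) ∈ Set.range fun σ => (h σ).im := by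
    apply mem_range_of_exists_le_of_exists_ge hhc
    · rcases le_total (h 0).im 0 with h' | h'
      · exact ⟨0, h'⟩
      · exact ⟨1, by rw [hflip]; linarith⟩
    · rcases le_total (h 0).im 0 with h' | h'
      · exact ⟨1, by rw [hflip]; linarith⟩
      · exact ⟨0, h'⟩
  obtain ⟨σ, hσ⟩ := hzero
  exact himne σ hσ

/-- The deck translation. -/
noncomputable def dk : ℂ := 2 * Real.pi * Complex.I

lemma dk_im : dk.im = 2 * Real.pi := by simp [dk]
lemma int_dk_im (q : ℤ) : ((q : ℂ) * dk).im = q * (2 * Real.pi) := by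
  simp [dk]

/-- A homeomorphism of the plane commuting with the deck translation, with its inverse. -/
structure DeckPair (G K : ℂ → ℂ) : Prop where
  contG : Continuous G
  contK : Continuous K
  GK : ∀ z, G (K z) = z
  KG : ∀ z, K (G z) = z
  T : ∀ z, G (z + dk) = G z + dk

lemma comm_int_of {G : ℂ → ℂ} (h : ∀ z, G (z + dk) = G z + dk) (q : ℤ) (z : ℂ) :
    G (z + q * dk) = G z + q * dk := by
  have hnat : ∀ n : ℕ, ∀ z, G (z + n * dk) = G z + n * dk := by
    intro n
    induction n with
    | zero => intro z; simp
    | succ n ih =>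
      intro z
      have : z + ((n + 1 : ℕ) : ℂ) * dk = (z + n * dk) + dk := by push_cast; ring
      rw [this, h, ih]; push_cast; ring
  rcases Int.eq_nat_or_neg q with ⟨n, rfl | rfl⟩
  · simpa using hnat n z
  · have := hnat n (z + ((-(n:ℤ) : ℤ) : ℂ) * dk)
    have e : z + ((-(n:ℤ) : ℤ) : ℂ) * dk + n * dk = z := by push_cast; ring
    rw [e] at this
    rw [this]; push_cast; ring

namespace DeckPair

variable {G K : ℂ → ℂ}

lemma comm_int (h : DeckPair G K) (q : ℤ) (z : ℂ) : G (z + q * dk) = G z + q * dk :=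
  comm_int_of h.T q z

lemma symm (h : DeckPair G K) : DeckPair K G where
  contG := h.contK
  contK := h.contG
  GK := h.KG
  KG := h.GK
  T z := by
    have := h.T (K z)
    rw [h.GK] at this
    rw [← this, h.KG]

lemma iter (h : DeckPair G K) (m : ℕ) : DeckPair (G^[m]) (K^[m]) where
  contG := h.contG.iterate m
  contK := h.contK.iterate m
  GK := Function.LeftInverse.iterate h.GK m
  KG := Function.LeftInverse.iterate h.KG m
  T z := by
    induction m with
    | zero => simp
    | succ n ih => rw [Function.iterate_succ_apply', ih, h.T, Function.iterate_succ_apply']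

lemma real_of_im {z : ℂ} (h : z.im = 0) : ((z.re : ℝ) : ℂ) = z := by
  apply Complex.ext <;> simp [h]

lemma below (h : DeckPair G K) (a : ℝ) (ha : ∀ s : ℝ, a < (G s).im) (z : ℂ) (hz : z.im ≤ a) :
    (K z).im < 0 := by
  have hconn : IsPreconnected {z : ℂ | z.im ≤ a} := (convex_halfSpace_im_le a).isPreconnected
  have hne : ∀ w ∈ {z : ℂ | z.im ≤ a}, (K w).im ≠ 0 := by
    intro w hw h0
    have h1 := ha (K w).re
    rw [real_of_im h0, h.GK] at h1
    exact absurd hw (not_le.2 h1)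
  obtain ⟨j, hj⟩ := exists_nat_gt ((G 0).im - a)
  obtain ⟨w, hw, hwn⟩ : ∃ w ∈ {z : ℂ | z.im ≤ a}, (K w).im < 0 := by
    refine ⟨G 0 + ((-((j : ℤ) + 1) : ℤ) : ℂ) * dk, ?_, ?_⟩
    · simp only [Set.mem_setOf_eq, Complex.add_im, int_dk_im]
      push_cast
      nlinarith [Real.pi_gt_three]
    · rw [← h.comm_int, h.KG, Complex.add_im, int_dk_im]
      push_cast
      simp only [Complex.zero_im]
      nlinarith [Real.pi_gt_three]
  by_contra hcon
  rw [not_lt] at hcon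
  obtain ⟨u, hu, hu0⟩ := hconn.intermediate_value hw hz
    (Complex.continuous_im.comp h.contK).continuousOn ⟨hwn.le, hcon⟩
  exact hne u hu hu0

lemma above (h : DeckPair G K) (a : ℝ) (ha : ∀ s : ℝ, (G s).im < a) (z : ℂ) (hz : a ≤ z.im) :
    0 < (K z).im := by
  have hconn : IsPreconnected {z : ℂ | a ≤ z.im} := (convex_halfSpace_im_ge a).isPreconnected
  have hne : ∀ w ∈ {z : ℂ | a ≤ z.im}, (K w).im ≠ 0 := by
    intro w hw h0
    have h1 := ha (K w).re
    rw [real_of_im h0, h.GK] at h1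
    exact absurd hw (not_le.2 h1)
  obtain ⟨j, hj⟩ := exists_nat_gt (a - (G 0).im)
  obtain ⟨w, hw, hwn⟩ : ∃ w ∈ {z : ℂ | a ≤ z.im}, 0 < (K w).im := by
    refine ⟨G 0 + ((((j : ℤ) + 1) : ℤ) : ℂ) * dk, ?_, ?_⟩
    · simp only [Set.mem_setOf_eq, Complex.add_im, int_dk_im]
      push_cast
      nlinarith [Real.pi_gt_three]
    · rw [← h.comm_int, h.KG, Complex.add_im, int_dk_im]
      push_cast
      simp only [Complex.zero_im]
      nlinarith [Real.pi_gt_three]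
  by_contra hcon
  rw [not_lt] at hcon
  obtain ⟨u, hu, hu0⟩ := hconn.intermediate_value hz hw
    (Complex.continuous_im.comp h.contK).continuousOn ⟨hcon, hwn.le⟩
  exact hne u hu hu0

lemma line_gt (h : DeckPair G K) (a : ℝ) (ha : ∀ s : ℝ, (G s).im ≠ a) (s₀ : ℝ)
    (hs₀ : a < (G s₀).im) (s : ℝ) : a < (G s).im := by
  by_contra hcon
  rw [not_lt] at hcon
  have hc : Continuous fun s : ℝ => (G s).im :=
    Complex.continuous_im.comp (h.contG.comp Complex.continuous_ofReal)
  obtain ⟨u, hu⟩ := mem_range_of_exists_le_of_exists_ge hc ⟨s, hcon⟩ ⟨s₀, hs₀.le⟩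
  exact ha u hu

lemma lemmaB (h : DeckPair G K) (c : ℂ) (hc : G c = c) (hc0 : 0 < c.im)
    (hc1 : c.im < 2 * Real.pi) (M : Set ℕ) (hM : ∀ N, ∃ m ∈ M, N ≤ m)
    (h1 : ∀ s : ℝ, (G s).im ≠ 0)
    (h2 : ∀ m ∈ M, ∀ s : ℝ, (G^[m] s).im ≠ 2 * Real.pi)
    (NW : ∀ V : Set ℂ, IsOpen V → V.Nonempty →
      ∃ n : ℕ, n ≠ 0 ∧ ∃ a ∈ V, ∃ q : ℤ, G^[n] a + q * dk ∈ V)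
    (hpos : 0 < (G 0).im) : False := by
  have hKc : K c = c := by
    have := h.KG c
    rwa [hc] at this
  have hline : ∀ s : ℝ, 0 < (G s).im := h.line_gt 0 h1 0 (by simpa using hpos)
  have hb : ∀ z : ℂ, z.im ≤ 0 → (K z).im < 0 := h.below 0 hline
  have hup : ∀ m ∈ M, ∀ z : ℂ, 2 * Real.pi ≤ z.im → 0 < (K^[m] z).im := by
    intro m hm
    apply (h.iter m).above
    intro s
    by_contra hcon
    rw [not_lt] at hcon
    have hgt := lt_of_le_of_ne hcon (h2 m hm s).symm
    have hall := (h.iter m).line_gt _ (h2 m hm) s hgt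
    have := (h.iter m).below _ hall c hc1.le
    rw [Function.iterate_fixed hKc] at this
    linarith
  -- monotonicity
  have hmono : ∀ (n : ℕ) (z : ℂ), z.im ≤ 0 → (K^[n] z).im ≤ 0 := by
    intro n
    induction n with
    | zero => intro z hz; simpa using hz
    | succ n ih => intro z hz; rw [Function.iterate_succ_apply]; exact ih _ (hb z hz).le
  have hGpos : ∀ (n : ℕ) (z : ℂ), 0 < z.im → 0 < (G^[n] z).im := by
    intro n z hz
    by_contra hcon
    have := hmono n _ (not_lt.1 hcon)
    rw [(h.iter n).KG] at this
    linarith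
  have hsmall : ∀ (n : ℕ) (z : ℂ), (K^[n] z).im ≤ 0 → z.im < 2 * Real.pi := by
    intro n z hz
    by_contra hcon
    obtain ⟨m, hm, hnm⟩ := hM n
    have h3 := hup m hm z (not_lt.1 hcon)
    obtain ⟨d, rfl⟩ := Nat.exists_eq_add_of_le' hnm
    rw [Function.iterate_add_apply] at h3
    have := hmono d _ hz
    linarith
  set V : Set ℂ := {z | 0 < z.im ∧ (K z).im < 0} with hV
  have hVo : IsOpen V := (isOpen_lt continuous_const Complex.continuous_im).inter
    (isOpen_lt (Complex.continuous_im.comp h.contK) continuous_const)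
  have hVne : V.Nonempty := by
    have hopen : IsOpen {z : ℂ | (K z).im < 0} :=
      isOpen_lt (Complex.continuous_im.comp h.contK) continuous_const
    obtain ⟨ε, hε, hball⟩ := Metric.isOpen_iff.1 hopen 0 (hb 0 (by simp))
    refine ⟨((ε / 2 : ℝ) : ℂ) * Complex.I, ?_, ?_⟩
    · simp [hε]
    · apply hball
      simp [abs_of_pos hε, hε]
  obtain ⟨n, hn, a, ha, q, hb'⟩ := NW V hVo hVne
  obtain ⟨n, rfl⟩ := Nat.exists_eq_succ_of_ne_zero hn
  have e1 : 0 < (G^[n+1] a).im := hGpos _ _ ha.1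
  have e2 : (G^[n+1] a).im < 2 * Real.pi := by
    apply hsmall (n + 2)
    rw [show n + 2 = 1 + (n + 1) by ring, Function.iterate_add_apply, (h.iter (n+1)).KG]
    exact ha.2.le
  have e3 := hb'.1
  have e4 : (G^[n+1] a + q * dk).im < 2 * Real.pi := hsmall 1 _ hb'.2.le
  have hq : q = 0 := by
    rw [Nat.succ_eq_add_one, Complex.add_im, int_dk_im] at e3
    rw [Complex.add_im, int_dk_im] at e4
    have hpi := Real.pi_pos
    have l1 : (-1 : ℝ) < q := by nlinarith
    have l2 : (q : ℝ) < 1 := by nlinarith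
    have l1' : -1 < q := by exact_mod_cast l1
    have l2' : q < 1 := by exact_mod_cast l2
    omega
  have e5 := hb'.2
  rw [hq, Nat.succ_eq_add_one, Function.iterate_succ_apply'] at e5
  simp only [Int.cast_zero, zero_mul, add_zero, h.KG] at e5
  have := hGpos n a ha.1
  linarith

end DeckPair

/-- An isotopy of the punctured plane starting at the identity. -/
structure IsoData (H : ℝ → ℂ → ℂ) : Prop where
  cont : ContinuousOn (fun p : ℝ × ℂ => H p.1 p.2) {p | p.2 ≠ 0}
  ne : ∀ t z, z ≠ 0 → H t z ≠ 0
  inj : ∀ t z w, z ≠ 0 → w ≠ 0 → H t z = H t w → z = w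
  zero : ∀ z, z ≠ 0 → H 0 z = z

lemma IsoData.comp_cont {H : ℝ → ℂ → ℂ} (hH : IsoData H) {X : Type*} [TopologicalSpace X]
    {u : X → ℝ} {v : X → ℂ} (hu : Continuous u) (hv : Continuous v) (h0 : ∀ x, v x ≠ 0) :
    Continuous fun x => H (u x) (v x) :=
  hH.cont.comp_continuous (hu.prodMk hv) h0

lemma continuous_iterate_param {X : Type*} [TopologicalSpace X] (Γ : ℝ → X → X)
    (hc : Continuous (fun p : ℝ × X => Γ p.1 p.2)) (m : ℕ) :
    Continuous (fun p : ℝ × X => (Γ p.1)^[m] p.2) := by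
  induction m with
  | zero => simpa using continuous_snd
  | succ n ih =>
    simp only [Function.iterate_succ_apply']
    exact hc.comp (continuous_fst.prodMk ih)

lemma exp_int_dk (z : ℂ) (q : ℤ) : Complex.exp (z + q * dk) = Complex.exp z := by
  rw [dk, Complex.exp_add, Complex.exp_int_mul_two_pi_mul_I, mul_one]

open ComplexConjugate in
lemma conj_dk : conj dk = - dk := by
  apply Complex.ext <;> simp [dk]

lemma dk_ne : dk ≠ 0 := by
  simp [dk, Real.pi_ne_zero]

open ComplexConjugate in
lemma core (H : ℝ → ℂ → ℂ) (hH : IsoData H)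
    (hrev : ∀ z, z ≠ 0 → H 1 (conj (H 1 (conj z))) = z)
    (NW : ∀ V : Set ℂ, IsOpen V → V.Nonempty → (0 : ℂ) ∉ V →
      ∃ n : ℕ, n ≠ 0 ∧ ∃ z ∈ V, (H 1)^[n] z ∈ V)
    (c : ℂ) (hc0 : c ≠ 0) (hc : H 1 c = c) (n₀ : ℕ) (hn₀ : 1 ≤ n₀) :
    ∃ m : ℕ, 1 ≤ m ∧ Nat.Coprime m n₀ ∧ ∃ x : ℝ, 0 < x ∧ (H 1)^[m] x = x := by
  by_contra hcon
  push Not at hcon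
  obtain ⟨L, hLc, hL⟩ := exists_log_lift (fun p : ℝ × ℂ => H p.1 (Complex.exp p.2))
    (hH.comp_cont continuous_fst (Complex.continuous_exp.comp continuous_snd)
      (fun x => Complex.exp_ne_zero _)) (fun p => hH.ne _ _ (Complex.exp_ne_zero _))
  obtain ⟨k₀, hk₀⟩ := log_lift_unique (fun z : ℂ => L (0, z)) (fun z => z) (by fun_prop)
    (by fun_prop) (fun z => by rw [hL, hH.zero _ (Complex.exp_ne_zero _)])
  change ∀ z : ℂ, L (0, z) = z + k₀ * dk at hk₀
  set Gt : ℝ → ℂ → ℂ := fun t z => L (t, z) + ((-k₀ : ℤ) : ℂ) * dk with hGt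
  have hGtc : Continuous (fun p : ℝ × ℂ => Gt p.1 p.2) := by
    simp only [hGt]; fun_prop
  have hGtexp : ∀ t z, Complex.exp (Gt t z) = H t (Complex.exp z) := by
    intro t z
    simp only [hGt]
    rw [exp_int_dk, hL]
  have hGt0 : ∀ z, Gt 0 z = z := by
    intro z; simp only [hGt]; rw [hk₀]; push_cast; ring
  have hGtT : ∀ t z, Gt t (z + dk) = Gt t z + dk := by
    obtain ⟨k, hk⟩ := log_lift_unique (fun p : ℝ × ℂ => Gt p.1 (p.2 + dk))
      (fun p : ℝ × ℂ => Gt p.1 p.2)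
      (hGtc.comp (by fun_prop : Continuous fun p : ℝ × ℂ => (p.1, p.2 + dk))) hGtc
      (fun p => by
        rw [hGtexp, hGtexp]
        have := exp_int_dk p.2 1
        simp only [Int.cast_one, one_mul] at this
        rw [this])
    change ∀ p : ℝ × ℂ, Gt p.1 (p.2 + dk) = Gt p.1 p.2 + k * dk at hk
    have h0 := hk (0, 0)
    simp only [hGt0] at h0
    have hk1 : (k : ℂ) = 1 := by
      have : (k : ℂ) * dk = 1 * dk := by linear_combination -h0
      exact mul_right_cancel₀ dk_ne this
    intro t z
    have := hk (t, z)
    rwa [hk1, one_mul] at this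
  have hGti : ∀ t, Function.Injective (Gt t) := by
    intro t a b hab
    have h1 := hH.inj t _ _ (Complex.exp_ne_zero a) (Complex.exp_ne_zero b)
      (by rw [← hGtexp, ← hGtexp, hab])
    obtain ⟨n, hn⟩ := Complex.exp_eq_exp_iff_exists_int.1 h1
    change a = b + n * dk at hn
    rw [hn, comm_int_of (hGtT t)] at hab
    have : (n : ℂ) * dk = 0 := by linear_combination hab
    rw [hn, this, add_zero]
  have hG1c : Continuous (Gt 1) := hGtc.comp (by fun_prop : Continuous fun z : ℂ => ((1:ℝ), z))
  -- reversibility of the lift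
  have hrevG1 : ∀ z, Gt 1 (conj (Gt 1 (conj z))) = z := by
    obtain ⟨k, hk⟩ := log_lift_unique (fun z : ℂ => Gt 1 (conj (Gt 1 (conj z)))) (fun z => z)
      (hG1c.comp (Complex.continuous_conj.comp (hG1c.comp Complex.continuous_conj)))
      continuous_id (fun z => by
        rw [hGtexp, Complex.exp_conj, hGtexp, Complex.exp_conj, hrev _ (Complex.exp_ne_zero _)])
    change ∀ z : ℂ, Gt 1 (conj (Gt 1 (conj z))) = z + k * dk at hk
    have h1 : Gt 1 (conj (Gt 1 (conj (Gt 1 (conj 0))))) = Gt 1 (conj 0) + k * dk := hk _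
    rw [hk 0] at h1
    have h2 : conj ((0 : ℂ) + k * dk) = conj 0 + ((-k : ℤ) : ℂ) * dk := by
      rw [map_add, map_mul, conj_dk, map_intCast]; push_cast; ring
    rw [h2, comm_int_of (hGtT 1)] at h1
    have h3 : (k : ℂ) * dk = 0 := by push_cast at h1; linear_combination (-1/2) * h1
    intro z
    rw [hk, h3, add_zero]
  -- the fixed point
  obtain ⟨c', hc', hc'0, hc'1⟩ : ∃ c' : ℂ, Complex.exp c' = c ∧ 0 ≤ c'.im ∧
      c'.im < 2 * Real.pi := by
    have hpi := Real.pi_pos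
    by_cases h : 0 ≤ (Complex.log c).im
    · exact ⟨Complex.log c, Complex.exp_log hc0, h, by have := Complex.log_im_le_pi c; linarith⟩
    · refine ⟨Complex.log c + ((1 : ℤ) : ℂ) * dk, by rw [exp_int_dk, Complex.exp_log hc0], ?_, ?_⟩
      · rw [Complex.add_im, int_dk_im]
        have := Complex.neg_pi_lt_log_im c
        push_cast; linarith
      · rw [Complex.add_im, int_dk_im]
        push_cast; linarith
  have hc'pos : 0 < c'.im := by
    refine lt_of_le_of_ne hc'0 fun h => ?_
    apply hcon 1 le_rfl (by simp) (Real.exp c'.re) (Real.exp_pos _)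
    rw [Complex.ofReal_exp, DeckPair.real_of_im h.symm, hc']
    simpa using hc
  obtain ⟨q₀, hq₀⟩ : ∃ q₀ : ℤ, Gt 1 c' = c' + q₀ * dk := by
    apply Complex.exp_eq_exp_iff_exists_int.1
    rw [hGtexp, hc', hc]
  set Gs : ℝ → ℂ → ℂ := fun t z => Gt t z - t * (q₀ * dk) with hGs
  have hGsc : Continuous (fun p : ℝ × ℂ => Gs p.1 p.2) := by
    simp only [hGs]
    apply hGtc.sub
    fun_prop
  have hGsi : ∀ t, Function.Injective (Gs t) := fun t a b hab => hGti t (by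
    simpa [hGs] using hab)
  have hGs0 : ∀ z, Gs 0 z = z := fun z => by simp [hGs, hGt0]
  set G : ℂ → ℂ := Gs 1 with hG
  have hGdef : ∀ z, G z = Gt 1 z - q₀ * dk := fun z => by simp [hG, hGs]
  set K : ℂ → ℂ := fun z => conj (G (conj z)) with hK
  have hGc : Continuous G := hGsc.comp (by fun_prop : Continuous fun z : ℂ => ((1:ℝ), z))
  have hGK : ∀ z, G (K z) = z := by
    intro z
    simp only [hK, hGdef, map_sub, map_mul, map_intCast, conj_dk]
    rw [show conj (Gt 1 (conj z)) - q₀ * -dk = conj (Gt 1 (conj z)) + q₀ * dk by ring,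
      comm_int_of (hGtT 1), hrevG1]
    ring
  have hKG : ∀ z, K (G z) = z := by
    intro z
    have := hGK (conj z)
    simp only [hK, Complex.conj_conj] at this ⊢
    rw [this, Complex.conj_conj]
  have hDP : DeckPair G K :=
    { contG := hGc
      contK := Complex.continuous_conj.comp (hGc.comp Complex.continuous_conj)
      GK := hGK
      KG := hKG
      T := fun z => by rw [hGdef, hGdef, hGtT]; ring }
  have hGfix : G c' = c' := by rw [hGdef, hq₀]; ring
  have hKit : ∀ (m : ℕ) z, conj (G^[m] (conj z)) = K^[m] z := by
    intro m
    induction m with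
    | zero => intro z; simp
    | succ n ih =>
      intro z
      rw [Function.iterate_succ_apply', Function.iterate_succ_apply', ← ih]
      simp [hK]
  have hexp : ∀ (m : ℕ) z, Complex.exp (G^[m] z) = (H 1)^[m] (Complex.exp z) := by
    intro m
    induction m with
    | zero => intro z; simp
    | succ n ih =>
      intro z
      rw [Function.iterate_succ_apply', Function.iterate_succ_apply', ← ih, ← hGtexp, hGdef]
      have := exp_int_dk (Gt 1 (G^[n] z)) (-q₀)
      rw [← this]
      congr 1
      push_cast; ring
  set M : Set ℕ := {m | 1 ≤ m ∧ Nat.Coprime m n₀} with hM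
  have hMinf : ∀ N, ∃ m ∈ M, N ≤ m := by
    intro N
    refine ⟨1 + N * n₀, ⟨by omega, ?_⟩, ?_⟩
    · simp
    · nlinarith
  have key : ∀ m ∈ M, ∀ (q : ℤ) (s : ℝ), (G^[m] s).im ≠ q * (2 * Real.pi) := by
    intro m hm q s him
    set Γ : ℝ → ℂ → ℂ := fun t z => (Gs t)^[m] z - t * (q * dk) with hΓ
    have hΓ1 : ∀ z, Γ 1 z = G^[m] z - q * dk := fun z => by simp [hΓ, hG]
    refine lemmaA Γ ?_ ?_ ?_ ?_ ?_ s ?_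
    · simp only [hΓ]
      apply (continuous_iterate_param Gs hGsc m).sub
      fun_prop
    · intro t a b hab
      exact (hGsi t).iterate m (by simpa [hΓ] using hab)
    · intro z
      have : (Gs 0) = id := funext hGs0
      simp [hΓ, this]
    · intro z
      simp only [hΓ1, map_sub, map_mul, map_intCast, conj_dk]
      rw [hKit, show K^[m] z - q * -dk = K^[m] z + q * dk by ring, (hDP.iter m).comm_int,
        (hDP.iter m).GK]
      ring
    · intro r hr
      rw [hΓ1] at hr
      apply hcon m hm.1 hm.2 (Real.exp r) (Real.exp_pos _)
      rw [Complex.ofReal_exp, ← hexp, show G^[m] r = r + q * dk by linear_combination hr,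
        exp_int_dk]
    · rw [hΓ1, Complex.sub_im, int_dk_im, him, sub_self]
  have hNWG : ∀ V : Set ℂ, IsOpen V → V.Nonempty →
      ∃ n : ℕ, n ≠ 0 ∧ ∃ a ∈ V, ∃ q : ℤ, G^[n] a + q * dk ∈ V := by
    intro V hV hVn
    obtain ⟨n, hn, z, ⟨a, ha, rfl⟩, ⟨b, hb, hab⟩⟩ := NW (Complex.exp '' V)
      (Complex.isOpenMap_exp V hV) (hVn.image _)
      (by rintro ⟨a, -, ha⟩; exact Complex.exp_ne_zero _ ha)
    rw [← hexp] at hab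
    obtain ⟨q, hq⟩ := Complex.exp_eq_exp_iff_exists_int.1 hab
    change b = G^[n] a + q * dk at hq
    exact ⟨n, hn, a, ha, q, hq ▸ hb⟩
  have h1M : (1 : ℕ) ∈ M := ⟨le_rfl, by simp⟩
  have hK_im : ∀ (m : ℕ) (s : ℝ), (K^[m] s).im = - (G^[m] s).im := by
    intro m s
    rw [← hKit, Complex.conj_ofReal, Complex.conj_im]
  have hne0 : ∀ s : ℝ, (G s).im ≠ 0 := by
    intro s
    have := key 1 h1M 0 s
    simpa using this
  rcases lt_or_gt_of_ne (hne0 0) with hneg | hpos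
  · refine hDP.symm.lemmaB c' ?_ hc'pos hc'1 M hMinf ?_ ?_ ?_ ?_
    · have := hKG c'
      rwa [hGfix] at this
    · intro s
      have := hK_im 1 s
      simp only [Function.iterate_one] at this
      rw [this]
      exact neg_ne_zero.2 (hne0 s)
    · intro m hm s h
      rw [hK_im] at h
      apply key m hm (-1) s
      push_cast; linarith
    · intro V hV hVn
      obtain ⟨n, hn, a, ha, q, hq⟩ := hNWG V hV hVn
      refine ⟨n, hn, _, hq, -q, ?_⟩
      rw [(hDP.iter n).symm.comm_int, (hDP.iter n).KG]
      convert ha using 1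
      push_cast; ring
    · have := hK_im 1 0
      simp only [Function.iterate_one, Complex.ofReal_zero] at this
      rw [this]
      rw [Complex.ofReal_zero] at hneg
      linarith
  · refine hDP.lemmaB c' hGfix hc'pos hc'1 M hMinf hne0 ?_ hNWG (by simpa using hpos)
    intro m hm s h
    apply key m hm 1 s
    push_cast; linarith

lemma lemmaW {H : ℝ → ℂ → ℂ} (hH : IsoData H) (t s : ℝ) (hs : 0 < s) (z : ℂ) (hz : s < ‖z‖) :
    ∃ u : ℂ, ‖u‖ = s ∧ ‖H t u‖ ≤ ‖H t z‖ := by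
  by_contra hcon
  push Not at hcon
  have hz0 : z ≠ 0 := by rintro rfl; simp at hz; linarith
  set u : ℝ → ℂ := fun θ => s * Complex.exp (θ * Complex.I) with hu
  have hsC : (s : ℂ) ≠ 0 := by exact_mod_cast hs.ne'
  have hu0 : ∀ θ, u θ ≠ 0 := fun θ => mul_ne_zero hsC (Complex.exp_ne_zero _)
  have hun : ∀ θ, ‖u θ‖ = s := by
    intro θ
    simp [hu, Complex.norm_exp_ofReal_mul_I, abs_of_pos hs]
  have huc : Continuous u := by fun_prop
  have hup : ∀ θ, u (θ + 2 * Real.pi) = u θ := by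
    intro θ
    simp only [hu]
    congr 1
    have := exp_int_dk (θ * Complex.I) 1
    rw [← this, dk]
    congr 1
    push_cast; ring
  set Φ : ℝ × ℝ → ℂ := fun p => 1 - H p.1 z / H p.1 (u p.2) with hΦ
  have hΦc : Continuous Φ := by
    refine continuous_const.sub (Continuous.div ?_ ?_ ?_)
    · exact hH.comp_cont continuous_fst continuous_const (fun _ => hz0)
    · exact hH.comp_cont continuous_fst (huc.comp continuous_snd) (fun _ => hu0 _)
    · exact fun p => hH.ne _ _ (hu0 _)
  have hΦ0 : ∀ p, Φ p ≠ 0 := by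
    intro p h
    simp only [hΦ] at h
    have h1 : H p.1 z = H p.1 (u p.2) := by
      have := hH.ne p.1 _ (hu0 p.2)
      field_simp at h
      linear_combination -h
    have h2 := hH.inj _ _ _ hz0 (hu0 _) h1
    rw [h2, hun] at hz
    exact lt_irrefl _ hz
  obtain ⟨L, hLc, hL⟩ := exists_log_lift Φ hΦc hΦ0
  obtain ⟨n, hn⟩ := log_lift_unique (fun p : ℝ × ℝ => L (p.1, p.2 + 2 * Real.pi)) L
    (by fun_prop) hLc (fun p => by rw [hL, hL]; simp only [hΦ, hup])
  -- slit plane computation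
  have slit : ∀ w : ℂ, ‖w‖ < 1 → 1 - w ∈ Complex.slitPlane := by
    intro w hw
    left
    simp only [Complex.sub_re, Complex.one_re]
    have := Complex.re_le_norm w
    linarith
  have hlt : ∀ θ, ‖H t z / H t (u θ)‖ < 1 := by
    intro θ
    rw [norm_div, div_lt_one (norm_pos_iff.2 (hH.ne _ _ (hu0 _)))]
    exact hcon _ (hun θ)
  obtain ⟨a, ha⟩ := log_lift_unique (fun θ : ℝ => L (t, θ)) (fun θ => Complex.log (Φ (t, θ)))
    (by fun_prop)
    (Continuous.clog (by fun_prop) (fun θ => slit _ (hlt θ)))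
    (fun θ => by rw [hL, Complex.exp_log (hΦ0 _)])
  have hn0 : (n : ℂ) * (2 * Real.pi * Complex.I) = 0 := by
    have h1 := hn (t, 0)
    have h2 := ha 0
    have h3 := ha (0 + 2 * Real.pi)
    have h4 : Φ (t, 0 + 2 * Real.pi) = Φ (t, 0) := by simp only [hΦ, hup]
    simp only [h4] at h3
    simp only at h1 h2
    rw [h3, h2] at h1
    linear_combination -h1
  have hlt0 : ∀ θ, ‖u θ / z‖ < 1 := by
    intro θ
    rw [norm_div, div_lt_one (norm_pos_iff.2 hz0), hun]
    exact hz
  obtain ⟨b, hb⟩ := log_lift_unique (fun θ : ℝ => L (0, θ))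
    (fun θ => Complex.log (-(z / s)) - θ * Complex.I + Complex.log (1 - u θ / z))
    (by fun_prop)
    (by
      apply Continuous.add (by fun_prop)
      exact Continuous.clog (by fun_prop) (fun θ => slit _ (hlt0 θ)))
    (fun θ => by
      rw [hL, Complex.exp_add, Complex.exp_sub, Complex.exp_log (by
          simp [hz0, hsC]), Complex.exp_log (Complex.slitPlane_ne_zero (slit _ (hlt0 θ)))]
      simp only [hΦ, hH.zero _ hz0, hH.zero _ (hu0 _)]
      simp only [hu]
      have := Complex.exp_ne_zero (θ * Complex.I)
      field_simp
      ring)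
  have h1 := hn (0, 0)
  have h2 := hb 0
  have h3 := hb (0 + 2 * Real.pi)
  rw [hn0] at h1
  simp only [hup] at h3
  simp only at h1 h2
  rw [h3, h2] at h1
  have h5 : ((2 * Real.pi : ℝ) : ℂ) * Complex.I = 0 := by
    push_cast at h1 ⊢
    linear_combination -h1
  simp [Real.pi_ne_zero] at h5

lemma ends {H : ℝ → ℂ → ℂ} (hH : IsoData H)
    (hinv : ∀ t, ∃ K : ℂ → ℂ, ContinuousOn K {0}ᶜ ∧ ∀ z, z ≠ 0 → K (H t z) = z)
    (t₀ ρ : ℝ) : ∃ r : ℝ, 0 < r ∧ ∀ᶠ t in 𝓝 t₀, ∀ z : ℂ, r < ‖z‖ → ρ < ‖H t z‖ := by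
  have hcs : ∀ t, ∀ s > 0, ContinuousOn (fun z => ‖H t z‖) (Metric.sphere (0:ℂ) s) := by
    intro t s hs
    apply ContinuousOn.norm
    refine hH.cont.comp (f := fun z : ℂ => (t, z)) (by fun_prop) ?_
    intro z hz
    have : ‖z‖ = s := by simpa using hz
    intro h0
    change z = 0 at h0
    rw [h0] at this; simp at this; linarith
  obtain ⟨u₁, hu₁, hmin⟩ := (isCompact_sphere (0:ℂ) 1).exists_isMinOn
    ⟨1, by simp⟩ (hcs t₀ 1 one_pos)
  have hu₁0 : u₁ ≠ 0 := by rintro rfl; simp at hu₁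
  set μ := ‖H t₀ u₁‖ with hμ
  have hμ0 : 0 < μ := norm_pos_iff.2 (hH.ne _ _ hu₁0)
  obtain ⟨K, hKc, hK⟩ := hinv t₀
  have hcomp : IsCompact (Metric.closedBall (0:ℂ) ρ ∩ (Metric.ball (0:ℂ) μ)ᶜ) :=
    (isCompact_closedBall _ _).inter_right Metric.isOpen_ball.isClosed_compl
  have himg := hcomp.image_of_continuousOn (hKc.mono (by
    rintro w ⟨-, hw⟩ rfl
    apply hw
    simpa using hμ0))
  obtain ⟨r, hr⟩ := himg.isBounded.exists_norm_le
  have hfar : ∀ z : ℂ, max r 1 < ‖z‖ → ρ < ‖H t₀ z‖ := by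
    intro z hz
    have hz1 : 1 < ‖z‖ := (le_max_right _ _).trans_lt hz
    have hz0 : z ≠ 0 := by rintro rfl; simp at hz1; linarith
    obtain ⟨u, hu, hle⟩ := lemmaW hH t₀ 1 one_pos z hz1
    have hge : μ ≤ ‖H t₀ z‖ := le_trans (hmin (by simpa using hu)) hle
    by_contra hcon
    have := hr z ⟨H t₀ z, ⟨by simpa using hcon, by simpa using hge⟩, hK z hz0⟩
    exact absurd ((le_max_left r 1).trans_lt hz) (not_lt.2 this)
  set s := max r 1 + 1 with hs
  have hs0 : 0 < s := by have := le_max_right r 1; linarith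
  refine ⟨s, hs0, ?_⟩
  have hev : ∀ᶠ t in 𝓝 t₀, ∀ u ∈ Metric.sphere (0:ℂ) s, ρ < ‖H t u‖ := by
    apply (isCompact_sphere (0:ℂ) s).eventually_forall_of_forall_eventually
    intro u hu
    have hun : ‖u‖ = s := by simpa using hu
    have hu0 : u ≠ 0 := by rintro rfl; simp at hun; linarith
    have hca : ContinuousAt (fun p : ℝ × ℂ => ‖H p.1 p.2‖) (t₀, u) := by
      apply ContinuousAt.norm
      apply hH.cont.continuousAt
      exact (isOpen_ne_fun continuous_snd continuous_const).mem_nhds hu0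
    exact hca.eventually (lt_mem_nhds (hfar u (by rw [hun]; linarith)))
  filter_upwards [hev] with t ht z hz
  obtain ⟨u, hu, hle⟩ := lemmaW hH t s hs0 z hz
  exact (ht u (by simpa using hu)).trans_le hle


open ComplexConjugate in
lemma step2 (H : ℝ → ℂ → ℂ) (hH : IsoData H)
    (hinv : ∀ t, ∃ K : ℂ → ℂ, ContinuousOn K {0}ᶜ ∧ ∀ z, z ≠ 0 → K (H t z) = z)
    (hrev : ∀ z, z ≠ 0 → H 1 (conj (H 1 (conj z))) = z)
    (NW : ∀ V : Set ℂ, IsOpen V → V.Nonempty → (0 : ℂ) ∉ V →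
      ∃ n : ℕ, n ≠ 0 ∧ ∃ z ∈ V, (H 1)^[n] z ∈ V)
    (p : ℝ) (hp0 : 0 < p) (hp : H 1 p = p) (n₀ : ℕ) (hn₀ : 1 ≤ n₀) :
    ∃ m : ℕ, 1 ≤ m ∧ Nat.Coprime m n₀ ∧ ∃ x : ℝ, 0 < x ∧ x < p ∧ (H 1)^[m] x = x := by
  have hpC : (p : ℂ) ≠ 0 := by exact_mod_cast hp0.ne'
  set Z : ℂ → ℂ := fun w => p * w / (1 + w) with hZ
  have h1w : ∀ w : ℂ, w ≠ -1 → 1 + w ≠ 0 := fun w hw h => hw (by linear_combination h)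
  have hZ0 : ∀ w, w ≠ 0 → w ≠ -1 → Z w ≠ 0 := fun w h0 h1 =>
    div_ne_zero (mul_ne_zero hpC h0) (h1w w h1)
  have hZp : ∀ w, w ≠ -1 → Z w ≠ p := by
    intro w h1 h
    have := h1w w h1
    simp only [hZ] at h
    field_simp at h
    exact hpC (by linear_combination (-(p:ℂ)) * h)
  have hZinj : ∀ w w', w ≠ -1 → w' ≠ -1 → Z w = Z w' → w = w' := by
    intro w w' h h' he
    have a := h1w w h
    have b := h1w w' h'
    simp only [hZ] at he
    field_simp at he
    linear_combination he
  set J : ℝ → ℂ → ℂ := fun t w => if w = -1 then -1 else H t (Z w) / (H t p - H t (Z w)) with hJ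
  have hJ1 : ∀ t, J t (-1) = -1 := fun t => by simp [hJ]
  have hJn : ∀ t w, w ≠ -1 → J t w = H t (Z w) / (H t p - H t (Z w)) :=
    fun t w h => by simp [hJ, h]
  have hden : ∀ t w, w ≠ 0 → w ≠ -1 → H t p - H t (Z w) ≠ 0 := by
    intro t w h0 h1 h
    exact hZp w h1 (hH.inj t _ _ hpC (hZ0 w h0 h1) (by linear_combination h)).symm
  have hJne1 : ∀ t w, w ≠ 0 → w ≠ -1 → J t w ≠ -1 := by
    intro t w h0 h1 h
    rw [hJn t w h1, div_eq_iff (hden t w h0 h1)] at h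
    exact hH.ne t p hpC (by linear_combination h)
  have hJne0 : ∀ t w, w ≠ 0 → J t w ≠ 0 := by
    intro t w h0
    by_cases h1 : w = -1
    · rw [h1, hJ1]; norm_num
    · rw [hJn t w h1]
      exact div_ne_zero (hH.ne t _ (hZ0 w h0 h1)) (hden t w h0 h1)
  have hJs : ∀ t w, w ≠ 0 → w ≠ -1 → J t w + 1 = H t p / (H t p - H t (Z w)) := by
    intro t w h0 h1
    rw [hJn t w h1]
    have := hden t w h0 h1
    field_simp
    ring
  have hZJ : ∀ w, w ≠ 0 → w ≠ -1 → Z (J 1 w) = H 1 (Z w) := by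
    intro w h0 h1
    have a := hden 1 w h0 h1
    have b := hJs 1 w h0 h1
    rw [hp] at a b
    simp only [hZ]
    rw [add_comm, b, hJn 1 w h1, hp]
    simp only [hZ] at a ⊢
    field_simp
  have hZc : ∀ w, Z (conj w) = conj (Z w) := by
    intro w; simp [hZ]
  have hconj1 : ∀ w : ℂ, w ≠ -1 → conj w ≠ -1 := by
    intro w h h'
    apply h
    have := congrArg conj h'
    simpa using this
  have hconj0 : ∀ w : ℂ, w ≠ 0 → conj w ≠ 0 := by
    intro w h; simpa using h
  have hiter : ∀ n : ℕ, ∀ w, w ≠ 0 → w ≠ -1 →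
      (J 1)^[n] w ≠ 0 ∧ (J 1)^[n] w ≠ -1 ∧ Z ((J 1)^[n] w) = (H 1)^[n] (Z w) := by
    intro n
    induction n with
    | zero => intro w h0 h1; exact ⟨h0, h1, rfl⟩
    | succ n ih =>
      intro w h0 h1
      obtain ⟨a, b, c⟩ := ih w h0 h1
      simp only [Function.iterate_succ_apply']
      exact ⟨hJne0 _ _ a, hJne1 _ _ a b, by rw [hZJ _ a b, c]⟩
  have hZcont : ∀ w, w ≠ -1 → ContinuousAt Z w := by
    intro w h
    exact ContinuousAt.div (by fun_prop) (by fun_prop) (h1w w h)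
  have hHcont : ∀ t z, z ≠ 0 → ContinuousAt (fun q : ℝ × ℂ => H q.1 q.2) (t, z) := by
    intro t z h
    exact hH.cont.continuousAt ((isOpen_ne_fun continuous_snd continuous_const).mem_nhds h)
  have hHp : ∀ t : ℝ, ContinuousAt (fun q : ℝ => H q p) t := by
    intro t
    exact (hHcont t p hpC).comp (f := fun q : ℝ => (q, (p:ℂ))) (by fun_prop)
  have hIso : IsoData J := by
    refine ⟨?_, hJne0, ?_, ?_⟩
    · rintro ⟨t, w⟩ hw
      change w ≠ 0 at hw
      apply ContinuousAt.continuousWithinAt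
      by_cases h1 : w = -1
      · subst h1
        rw [Metric.continuousAt_iff']
        intro ε hε
        set B := ‖H t p‖ + 1 with hB
        have hBpos : 0 < B := by positivity
        obtain ⟨r, hr, hev⟩ := ends hH hinv t (B + B / ε)
        have hZfar : ∀ᶠ w in 𝓝 (-1:ℂ), w ≠ -1 → r < ‖Z w‖ := by
          have hball : ∀ᶠ w in 𝓝 (-1:ℂ), ‖w + 1‖ < min (1/2) (p / (2 * r)) := by
            have : ContinuousAt (fun w : ℂ => ‖w + 1‖) (-1) := by fun_prop
            apply this.eventually_lt_const
            simp; positivity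
          filter_upwards [hball] with w hw1 hne
          have a : ‖w + 1‖ < 1/2 := hw1.trans_le (min_le_left _ _)
          have b : ‖w + 1‖ < p / (2 * r) := hw1.trans_le (min_le_right _ _)
          have hpos : 0 < ‖1 + w‖ := norm_pos_iff.2 (h1w w hne)
          have hwn : 1/2 < ‖w‖ := by
            have : ‖(1:ℂ)‖ ≤ ‖w + 1‖ + ‖w‖ := by
              calc ‖(1:ℂ)‖ = ‖(w + 1) - w‖ := by congr 1; ring
                _ ≤ _ := norm_sub_le _ _
            simp at this
            linarith
          simp only [hZ, norm_div, norm_mul, Complex.norm_real, Real.norm_eq_abs, abs_of_pos hp0]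
          rw [lt_div_iff₀ hpos]
          rw [add_comm, lt_div_iff₀ (by positivity)] at b
          nlinarith
        have hHB : ∀ᶠ s in 𝓝 t, ‖H s p‖ < B :=
          (hHp t).norm.eventually_lt_const (by rw [hB]; linarith)
        have hne0 : ∀ᶠ w in 𝓝 (-1:ℂ), w ≠ 0 := isOpen_ne.mem_nhds (by norm_num)
        rw [nhds_prod_eq]
        filter_upwards [(hev.and hHB).prod_mk (hZfar.and hne0)] with q hq
        obtain ⟨⟨q1, q2⟩, q3, q4⟩ := hq
        simp only [hJ1]
        by_cases hq1 : q.2 = -1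
        · rw [hq1, hJ1]; simpa using hε
        · rw [dist_eq_norm, sub_neg_eq_add, hJs _ _ q4 hq1, norm_div]
          have c1 := q1 _ (q3 hq1)
          have c2 : B / ε < ‖H q.1 p - H q.1 (Z q.2)‖ := by
            have := norm_sub_norm_le (H q.1 (Z q.2)) (H q.1 p)
            rw [norm_sub_rev] at this
            linarith
          have c3 : 0 < B / ε := by positivity
          rw [div_lt_iff₀ (c3.trans c2)]
          rw [div_lt_iff₀ hε] at c2
          linarith
      · have e : (fun q : ℝ × ℂ => J q.1 q.2) =ᶠ[𝓝 (t, w)]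
            fun q => H q.1 (Z q.2) / (H q.1 p - H q.1 (Z q.2)) := by
          have : ∀ᶠ q : ℝ × ℂ in 𝓝 (t, w), q.2 ≠ -1 :=
            (isOpen_ne_fun continuous_snd continuous_const).mem_nhds h1
          filter_upwards [this] with q hq
          exact hJn _ _ hq
        refine ContinuousAt.congr ?_ e.symm
        have c1 : ContinuousAt (fun q : ℝ × ℂ => H q.1 (Z q.2)) (t, w) := by
          refine ContinuousAt.comp (g := fun q : ℝ × ℂ => H q.1 q.2)
            (f := fun q : ℝ × ℂ => (q.1, Z q.2)) (hHcont t (Z w) (hZ0 w hw h1)) ?_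
          exact continuousAt_fst.prodMk
            (ContinuousAt.comp (g := Z) (f := Prod.snd) (hZcont w h1) continuousAt_snd)
        have c2 : ContinuousAt (fun q : ℝ × ℂ => H q.1 p) (t, w) :=
          ContinuousAt.comp (g := fun s : ℝ => H s p) (f := Prod.fst) (hHp t) continuousAt_fst
        exact c1.div (c2.sub c1) (hden t w hw h1)
    · intro t w w' h0 h0' he
      by_cases h1 : w = -1
      · by_cases h1' : w' = -1
        · rw [h1, h1']
        · rw [h1, hJ1] at he
          exact absurd he.symm (hJne1 _ _ h0' h1')
      · by_cases h1' : w' = -1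
        · rw [h1', hJ1] at he
          exact absurd he (hJne1 _ _ h0 h1)
        · rw [hJn _ _ h1, hJn _ _ h1', div_eq_div_iff (hden t w h0 h1) (hden t w' h0' h1')] at he
          apply hZinj w w' h1 h1'
          apply hH.inj t _ _ (hZ0 w h0 h1) (hZ0 w' h0' h1')
          apply mul_left_cancel₀ (hH.ne t p hpC)
          linear_combination he
    · intro w h0
      by_cases h1 : w = -1
      · rw [h1, hJ1]
      · rw [hJn _ _ h1, hH.zero _ hpC, hH.zero _ (hZ0 w h0 h1)]
        have a := h1w w h1
        have : (p:ℂ) - Z w = p / (1 + w) := by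
          simp only [hZ]; field_simp; ring
        rw [this]
        simp only [hZ]
        field_simp
  have hrevJ : ∀ w, w ≠ 0 → J 1 (conj (J 1 (conj w))) = w := by
    intro w h0
    by_cases h1 : w = -1
    · rw [h1]; simp [hJ1]
    · have a0 := hconj0 _ h0
      have a1 := hconj1 _ h1
      have b0 := hconj0 _ (hJne0 1 _ a0)
      have b1 := hconj1 _ (hJne1 1 _ a0 a1)
      apply hZinj _ _ (hJne1 1 _ b0 b1) h1
      rw [hZJ _ b0 b1, hZc, hZJ _ a0 a1, hZc, hrev _ (hZ0 w h0 h1)]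
  have hNWJ : ∀ V : Set ℂ, IsOpen V → V.Nonempty → (0 : ℂ) ∉ V →
      ∃ n : ℕ, n ≠ 0 ∧ ∃ z ∈ V, (J 1)^[n] z ∈ V := by
    intro V hV hVn hV0
    set W : ℂ → ℂ := fun z => z / (p - z) with hW
    have hWc : ContinuousOn W {(p:ℂ)}ᶜ := by
      apply ContinuousOn.div (by fun_prop) (by fun_prop)
      intro z hz h
      exact hz (by simp only [Set.mem_singleton_iff]; linear_combination -h)
    have hWZ : ∀ w, w ≠ -1 → W (Z w) = w := by
      intro w h1
      have a := h1w w h1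
      have : (p:ℂ) - Z w = p / (1 + w) := by
        simp only [hZ]; field_simp; ring
      simp only [hW]
      rw [this]
      simp only [hZ]
      field_simp
    have hZW : ∀ z : ℂ, z ≠ p → Z (W z) = z ∧ W z ≠ -1 := by
      intro z hz
      have a : (p:ℂ) - z ≠ 0 := fun h => hz (by linear_combination -h)
      have : 1 + W z = p / (p - z) := by
        simp only [hW]; field_simp; ring
      constructor
      · simp only [hZ]
        rw [this]
        simp only [hW]
        field_simp
      · intro h
        rw [h] at this
        have h2 : (p:ℂ) / (p - z) ≠ 0 := div_ne_zero hpC a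
        exact h2 (by rw [← this]; ring)
    have hVopen := hWc.isOpen_inter_preimage isOpen_compl_singleton hV
    obtain ⟨v, hv, hv1⟩ := (dense_compl_singleton (-1:ℂ)).inter_open_nonempty V hV hVn
    obtain ⟨n, hn, z, ⟨hz1, hz2⟩, hz3, hz4⟩ := NW _ hVopen
      ⟨Z v, hZp v hv1, by rw [Set.mem_preimage, hWZ v hv1]; exact hv⟩
      (by rintro ⟨-, h⟩; rw [Set.mem_preimage] at h; simp [hW] at h; exact hV0 h)
    obtain ⟨e1, e2⟩ := hZW z hz1
    refine ⟨n, hn, W z, hz2, ?_⟩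
    have e3 : W z ≠ 0 := fun h => hV0 (by rw [← h]; exact hz2)
    obtain ⟨f1, f2, f3⟩ := hiter n (W z) e3 e2
    rw [e1] at f3
    rw [Set.mem_preimage, ← f3, hWZ _ f2] at hz4
    exact hz4
  obtain ⟨m, hm, hmc, x, hx, hxx⟩ := core J hIso hrevJ hNWJ (-1) (by norm_num) (hJ1 1) n₀ hn₀
  refine ⟨m, hm, hmc, p * x / (1 + x), by positivity, ?_, ?_⟩
  · rw [div_lt_iff₀ (by positivity)]; nlinarith
  · have x0 : (x:ℂ) ≠ 0 := by exact_mod_cast hx.ne'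
    have x1 : (x:ℂ) ≠ -1 := by
      intro h
      have : x = -1 := by exact_mod_cast h
      linarith
    have := (hiter m x x0 x1).2.2
    rw [hxx] at this
    simp only [hZ] at this
    push_cast
    exact this.symm

/-- The annulus as the punctured plane. -/
noncomputable def toC (q : AnnO) : ℂ :=
  (((q.2 : ℝ) / (1 - (q.2 : ℝ)) : ℝ) : ℂ) * (AddCircle.toCircle q.1 : ℂ)

lemma toC_pos (q : AnnO) : 0 < (q.2 : ℝ) / (1 - (q.2 : ℝ)) := by
  obtain ⟨h0, h1⟩ := q.2.2
  apply div_pos h0; linarith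

lemma toC_ne (q : AnnO) : toC q ≠ 0 := by
  apply mul_ne_zero
  · exact_mod_cast (toC_pos q).ne'
  · exact Circle.coe_ne_zero _

lemma norm_toC (q : AnnO) : ‖toC q‖ = (q.2 : ℝ) / (1 - (q.2 : ℝ)) := by
  rw [toC, norm_mul, Circle.norm_coe, mul_one, Complex.norm_real, Real.norm_eq_abs,
    abs_of_pos (toC_pos q)]

lemma continuous_toC : Continuous toC := by
  unfold toC
  apply Continuous.mul
  · apply Complex.continuous_ofReal.comp
    apply Continuous.div (by fun_prop) (by fun_prop)
    intro q
    have := q.2.2.2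
    linarith
  · exact continuous_subtype_val.comp (AddCircle.continuous_toCircle.comp continuous_fst)

/-- The unit vector of a nonzero complex number. -/
noncomputable def unitC (z : {z : ℂ // z ≠ 0}) : Circle :=
  ⟨(z : ℂ) / (‖(z : ℂ)‖ : ℝ), by
    have h : ‖(z : ℂ)‖ ≠ 0 := norm_ne_zero_iff.2 z.2
    rw [Submonoid.unitSphere, ← SetLike.mem_coe]
    simp [h]⟩

lemma continuous_unitC : Continuous unitC := by
  unfold unitC
  apply Continuous.subtype_mk
  apply Continuous.div (by fun_prop) (by fun_prop)
  intro z
  have h : ‖(z : ℂ)‖ ≠ 0 := norm_ne_zero_iff.2 z.2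
  exact_mod_cast h

/-- The inverse of `toC` on nonzero complex numbers. -/
noncomputable def fromC' (z : {z : ℂ // z ≠ 0}) : AnnO :=
  ((AddCircle.homeomorphCircle (one_ne_zero : (1:ℝ) ≠ 0)).symm (unitC z),
    ⟨‖(z : ℂ)‖ / (1 + ‖(z : ℂ)‖), by
      have h : 0 < ‖(z : ℂ)‖ := norm_pos_iff.2 z.2
      constructor
      · positivity
      · rw [div_lt_one (by positivity)]; linarith⟩)

lemma continuous_fromC' : Continuous fromC' := by
  unfold fromC'
  apply Continuous.prodMk
  · exact (Homeomorph.continuous _).comp continuous_unitC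
  · apply Continuous.subtype_mk
    apply Continuous.div (by fun_prop) (by fun_prop)
    intro z
    positivity

/-- The inverse of `toC`, with a junk value at zero. -/
noncomputable def fromC (z : ℂ) : AnnO :=
  if h : z ≠ 0 then fromC' ⟨z, h⟩ else (0, ⟨1/2, by norm_num, by norm_num⟩)

lemma continuousOn_fromC : ContinuousOn fromC {0}ᶜ := by
  rw [continuousOn_iff_continuous_domRestrict]
  have e : ∀ z : ↥({0}ᶜ : Set ℂ), fromC' ⟨(z : ℂ), z.2⟩ = fromC (z : ℂ) := by
    intro z
    have hz : (z : ℂ) ≠ 0 := z.2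
    rw [fromC, dif_pos hz]
  exact (continuous_fromC'.comp (continuous_subtype_val.subtype_mk
    (fun z : ↥({0}ᶜ : Set ℂ) => z.2))).congr e

lemma toC_fromC {z : ℂ} (hz : z ≠ 0) : toC (fromC z) = z := by
  have h : 0 < ‖z‖ := norm_pos_iff.2 hz
  have h2 : AddCircle.toCircle (fromC z).1 = unitC ⟨z, hz⟩ := by
    rw [fromC, dif_pos hz, fromC', ← AddCircle.homeomorphCircle_apply one_ne_zero,
      Homeomorph.apply_symm_apply]
  rw [toC, h2]
  have h3 : ((fromC z).2 : ℝ) = ‖z‖ / (1 + ‖z‖) := by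
    rw [fromC, dif_pos hz, fromC']
  rw [h3]
  have h4 : ‖z‖ / (1 + ‖z‖) / (1 - ‖z‖ / (1 + ‖z‖)) = ‖z‖ := by
    have : 1 - ‖z‖ / (1 + ‖z‖) = 1 / (1 + ‖z‖) := by field_simp; ring
    rw [this]; field_simp
  rw [h4]
  have h5 : (unitC ⟨z, hz⟩ : ℂ) = z / (‖z‖ : ℝ) := rfl
  rw [h5]
  have : ((‖z‖ : ℝ) : ℂ) ≠ 0 := by exact_mod_cast h.ne'
  field_simp

lemma toC_injective : Function.Injective toC := by
  intro q q' h
  have hn : (q.2 : ℝ) / (1 - (q.2 : ℝ)) = (q'.2 : ℝ) / (1 - (q'.2 : ℝ)) := by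
    rw [← norm_toC, ← norm_toC, h]
  have a : (1 - (q.2 : ℝ)) ≠ 0 := by have := q.2.2.2; linarith
  have b : (1 - (q'.2 : ℝ)) ≠ 0 := by have := q'.2.2.2; linarith
  have e2 : q.2 = q'.2 := by
    apply Subtype.ext
    rw [div_eq_div_iff a b] at hn
    linarith
  rw [toC, toC, hn] at h
  have h6 := mul_left_cancel₀ (by exact_mod_cast (toC_pos q').ne') h
  have h7 : AddCircle.toCircle q.1 = AddCircle.toCircle q'.1 := Circle.ext h6
  exact Prod.ext (AddCircle.injective_toCircle one_ne_zero h7) e2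

lemma fromC_toC (q : AnnO) : fromC (toC q) = q :=
  toC_injective (toC_fromC (toC_ne q))

open ComplexConjugate in
lemma toC_RO (q : AnnO) : toC (RO q) = conj (toC q) := by
  simp only [toC, RO, map_mul, Complex.conj_ofReal, AddCircle.toCircle_neg, Circle.coe_inv_eq_conj]

lemma RO_RO (q : AnnO) : RO (RO q) = q := by
  simp [RO]

lemma RO_fromC (x : ℝ) (hx : 0 < x) : RO (fromC x) = fromC x := by
  apply toC_injective
  have : (x : ℂ) ≠ 0 := by exact_mod_cast hx.ne'
  rw [toC_RO, toC_fromC this, Complex.conj_ofReal]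

lemma rev_iter (f : AnnO ≃ₜ AnnO) (hrev : ∀ z, f (RO z) = RO (f.symm z)) (N : ℕ) :
    ∀ q, (⇑f)^[N] (RO ((⇑f)^[N] (RO q))) = q := by
  have h1 : ∀ q, f (RO (f q)) = RO q := by intro q; rw [hrev, f.symm_apply_apply]
  have h2 : ∀ N : ℕ, ∀ q, (⇑f)^[N] (RO ((⇑f)^[N] q)) = RO q := by
    intro N
    induction N with
    | zero => intro q; rfl
    | succ n ih =>
      intro q
      rw [Function.iterate_succ_apply, Function.iterate_succ_apply' (⇑f) n q, h1, ih]
  intro q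
  rw [h2, RO_RO]

open ComplexConjugate in
lemma transport (f : AnnO ≃ₜ AnnO)
    (hiso : IsotopicToIdO f) (harea : PreservesFiniteAreaO f)
    (hrev : ∀ z, f (RO z) = RO (f.symm z)) (N : ℕ) :
    ∃ H : ℝ → ℂ → ℂ, IsoData H ∧
    (∀ t, ∃ K : ℂ → ℂ, ContinuousOn K {0}ᶜ ∧ ∀ z, z ≠ 0 → K (H t z) = z) ∧
    (∀ z, z ≠ 0 → H 1 (conj (H 1 (conj z))) = z) ∧
    (∀ V : Set ℂ, IsOpen V → V.Nonempty → (0 : ℂ) ∉ V →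
      ∃ n : ℕ, n ≠ 0 ∧ ∃ z ∈ V, (H 1)^[n] z ∈ V) ∧
    (∀ n : ℕ, ∀ z, z ≠ 0 → (H 1)^[n] z = toC ((⇑f)^[N * n] (fromC z))) := by
  obtain ⟨H0, hc, h0, h1, hg⟩ := hiso
  set Γ : ℝ → AnnO → AnnO := fun t q => H0 (Set.projIcc 0 1 zero_le_one t, q) with hΓ
  have hΓc : Continuous (fun p : ℝ × AnnO => Γ p.1 p.2) := by
    simp only [hΓ]
    exact hc.comp ((continuous_projIcc.comp continuous_fst).prodMk continuous_snd)
  have hΓ0 : ∀ q, Γ 0 q = q := by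
    intro q; simp only [hΓ]; rw [Set.projIcc_left]; exact h0 q
  have hΓ1 : Γ 1 = f := by
    funext q; simp only [hΓ]; rw [Set.projIcc_right]; exact h1 q
  have hΓg : ∀ t, ∃ g : AnnO ≃ₜ AnnO, Γ t = g := by
    intro t
    obtain ⟨g, hg⟩ := hg (Set.projIcc 0 1 zero_le_one t)
    exact ⟨g, funext hg⟩
  have hit := continuous_iterate_param Γ hΓc N
  set H : ℝ → ℂ → ℂ := fun t z => toC ((Γ t)^[N] (fromC z)) with hH
  have hHn : ∀ n : ℕ, ∀ z, z ≠ 0 → (H 1)^[n] z = toC ((⇑f)^[N * n] (fromC z)) := by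
    intro n z hz
    induction n with
    | zero => simp [toC_fromC hz]
    | succ n ih =>
      rw [Function.iterate_succ_apply', ih]
      simp only [hH]
      rw [fromC_toC, hΓ1, ← Function.iterate_add_apply, Nat.mul_succ, Nat.add_comm]
  have hH1 : ∀ z, H 1 z = toC ((⇑f)^[N] (fromC z)) := by
    intro z; simp only [hH, hΓ1]
  refine ⟨H, ⟨?_, ?_, ?_, ?_⟩, ?_, ?_, ?_, hHn⟩
  · simp only [hH]
    apply continuous_toC.comp_continuousOn
    exact hit.comp_continuousOn (continuousOn_fst.prodMk
      (continuousOn_fromC.comp continuousOn_snd (fun p hp => hp)))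
  · intro t z hz
    exact toC_ne _
  · intro t z w hz hw h
    obtain ⟨g, hg⟩ := hΓg t
    have h2 := toC_injective h
    rw [hg] at h2
    have h3 := g.injective.iterate N h2
    rw [← toC_fromC hz, ← toC_fromC hw, h3]
  · intro z hz
    have : Γ 0 = id := funext hΓ0
    simp only [hH, this, Function.iterate_id, id, toC_fromC hz]
  · intro t
    obtain ⟨g, hg⟩ := hΓg t
    refine ⟨fun z => toC ((⇑g.symm)^[N] (fromC z)), ?_, ?_⟩
    · exact continuous_toC.comp_continuousOn
        ((g.symm.continuous.iterate N).comp_continuousOn continuousOn_fromC)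
    · intro z hz
      simp only [hH, hg, fromC_toC]
      have : Function.LeftInverse (⇑g.symm)^[N] (⇑g)^[N] :=
        Function.LeftInverse.iterate g.symm_apply_apply N
      rw [this, toC_fromC hz]
  · intro z hz
    have e : ∀ q, conj (toC q) = toC (RO q) := fun q => (toC_RO q).symm
    have e2 : fromC (conj z) = RO (fromC z) := by
      apply toC_injective
      rw [toC_RO, toC_fromC hz, toC_fromC (by simpa using hz)]
    rw [hH1, hH1, e, fromC_toC, e2, rev_iter f hrev, toC_fromC hz]
  · intro V hV hVn hV0
    obtain ⟨μ, hfin, -, hpos, hmp⟩ := harea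
    have : IsFiniteMeasure μ := ⟨hfin⟩
    have hO : IsOpen (toC ⁻¹' V) := hV.preimage continuous_toC
    have hne : (toC ⁻¹' V).Nonempty := by
      obtain ⟨v, hv⟩ := hVn
      refine ⟨fromC v, ?_⟩
      rw [Set.mem_preimage, toC_fromC (fun h => hV0 (h ▸ hv))]
      exact hv
    have hcons := (hmp.iterate N).conservative
    obtain ⟨q, hq, n, hn, hqn⟩ := hcons.exists_mem_iterate_mem
      hO.measurableSet.nullMeasurableSet (hpos _ hO hne).ne'
    refine ⟨n, hn, toC q, hq, ?_⟩
    rw [hHn n _ (toC_ne q), fromC_toC, Function.iterate_mul]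
    exact hqn

/-- Refinement of Franks' theorem for reversible maps (open annulus): if a
reversible area-preserving homeomorphism of the open annulus isotopic to the
identity has a `k`-periodic point with `gcd(k, n₀) = 1`, then it has infinitely
many symmetric periodic points whose minimal period is coprime to `n₀`. -/
theorem franks_reversible_refinement_open (f : AnnO ≃ₜ AnnO)
    (hiso : IsotopicToIdO f) (harea : PreservesFiniteAreaO f)
    (hrev : ∀ z, f (RO z) = RO (f.symm z))
    (k n₀ : ℕ) (hk : 1 ≤ k) (hn₀ : 1 ≤ n₀) (hcop : Nat.gcd k n₀ = 1)
    (z : AnnO) (hz : (⇑f)^[k] z = z) :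
    {w : AnnO | 0 < Function.minimalPeriod (⇑f) w ∧
      Nat.Coprime (Function.minimalPeriod (⇑f) w) n₀ ∧
      (∃ j : ℕ, RO w = (⇑f)^[j] w)}.Infinite := by
  intro hfin
  set X : Set ℝ := {x | 0 < x ∧ ∃ m : ℕ, 1 ≤ m ∧ Nat.Coprime m n₀ ∧
    (⇑f)^[m] (fromC x) = fromC x} with hX
  have hXfin : X.Finite := by
    refine Set.Finite.of_injOn (f := fun x : ℝ => fromC x) ?_ ?_ hfin
    · rintro x ⟨hx, m, hm, hmc, hfm⟩
      have hdvd : Function.minimalPeriod (⇑f) (fromC x) ∣ m :=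
        Function.IsPeriodicPt.minimalPeriod_dvd hfm
      refine ⟨Nat.pos_of_dvd_of_pos hdvd hm, Nat.Coprime.coprime_dvd_left hdvd hmc, 0, ?_⟩
      exact RO_fromC x hx
    · rintro x ⟨hx, -⟩ y ⟨hy, -⟩ h
      have h' : toC (fromC x) = toC (fromC y) := congrArg toC h
      rw [toC_fromC (by exact_mod_cast hx.ne'), toC_fromC (by exact_mod_cast hy.ne')] at h'
      exact_mod_cast h'
  have hXne : X.Nonempty := by
    obtain ⟨H, h1, h2, h3, h4, h5⟩ := transport f hiso harea hrev k
    have hfix : H 1 (toC z) = toC z := by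
      have := h5 1 (toC z) (toC_ne z)
      rw [Function.iterate_one, mul_one, fromC_toC, hz] at this
      exact this
    obtain ⟨m, hm, hmc, x, hx, hxx⟩ := core H h1 h3 h4 (toC z) (toC_ne z) hfix n₀ hn₀
    have hx0 : (x : ℂ) ≠ 0 := by exact_mod_cast hx.ne'
    refine ⟨x, hx, k * m, Nat.mul_pos hk hm, Nat.Coprime.mul_left hcop hmc, ?_⟩
    rw [h5 m x hx0] at hxx
    apply toC_injective
    rw [hxx, toC_fromC hx0]
  obtain ⟨p, ⟨hp, N, hN, hNc, hfN⟩, hmin⟩ := Set.exists_min_image X id hXfin hXne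
  obtain ⟨H, h1, h2, h3, h4, h5⟩ := transport f hiso harea hrev N
  have hp0 : (p : ℂ) ≠ 0 := by exact_mod_cast hp.ne'
  have hfix : H 1 p = p := by
    have := h5 1 p hp0
    rw [Function.iterate_one, mul_one, hfN, toC_fromC hp0] at this
    exact this
  obtain ⟨m, hm, hmc, x, hx, hxp, hxx⟩ := step2 H h1 h2 h3 h4 p hp hfix n₀ hn₀
  have hx0 : (x : ℂ) ≠ 0 := by exact_mod_cast hx.ne'
  have := hmin x ⟨hx, N * m, Nat.mul_pos hN hm, Nat.Coprime.mul_left hNc hmc, by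
    rw [h5 m x hx0] at hxx
    apply toC_injective
    rw [hxx, toC_fromC hx0]⟩
  simp only [id] at this
  linarith
end

section
/- Let f be a reversible homeomorphism of the closed annulus A = (ℝ/ℤ) × [0,1] that is isotopic to the identity, and let F be a lift of f to ℝ × [0,1] commuting with T(x,y) = (x+1,y). Suppose there exist positively recurrent points z₁, z₂ of f having rotation numbers ρ⁻ and ρ⁺ for F with ρ⁻ < 0 < ρ⁺. Then there exist two distinct fixed points w₁, w₂ of f in the interior (ℝ/ℤ) × (0,1) such that R(w₁) = w₁ and R(w₂) = w₂ (the circle coordinate of w₁ is 0 mod 1 and that of w₂ is 1/2 mod 1), and each wᵢ admits a lift w̃ᵢ ∈ ℝ × (0,1) with F(w̃ᵢ) = w̃ᵢ (i.e. each is a symmetric fixed point of zero rotation number). -/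
open MeasureTheory Filter Topology

/-- The closed annulus `(ℝ/ℤ) × [0,1]`. -/
abbrev AnnC : Type := Circle1 × ↥(Set.Icc (0 : ℝ) 1)

/-- The universal covering space `ℝ × [0,1]` of the closed annulus. -/
abbrev StripC : Type := ℝ × ↥(Set.Icc (0 : ℝ) 1)

/-- The covering map `π(x, y) = (x mod 1, y)`. -/
noncomputable def projC : StripC → AnnC := fun p => ((p.1 : Circle1), p.2)

/-- The deck transformation `T(x, y) = (x + 1, y)`. -/
def deckC : StripC → StripC := fun p => (p.1 + 1, p.2)

/-- The reflection `R(θ, y) = (−θ, y)` of the closed annulus. -/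
noncomputable def RC : AnnC → AnnC := fun z => (-z.1, z.2)

/-- `f` is isotopic to the identity. -/
def IsotopicToIdC (f : AnnC → AnnC) : Prop :=
  ∃ H : ↥(Set.Icc (0 : ℝ) 1) × AnnC → AnnC, Continuous H ∧
    (∀ z, H (⟨0, by norm_num⟩, z) = z) ∧
    (∀ z, H (⟨1, by norm_num⟩, z) = f z) ∧
    (∀ t, ∃ g : AnnC ≃ₜ AnnC, ∀ z, H (t, z) = g z)

/-- `z` is positively recurrent for `f`. -/
def PosRecurrentC (f : AnnC → AnnC) (z : AnnC) : Prop :=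
  ∀ U ∈ 𝓝 z, ∀ N : ℕ, ∃ n ≥ N, f^[n] z ∈ U

/-- The positively recurrent point `z` has rotation number `ρ` for the lift `F`. -/
def HasRotNumC (f : AnnC → AnnC) (F : StripC → StripC) (z : AnnC) (ρ : ℝ) : Prop :=
  ∀ zt : StripC, projC zt = z →
    ∀ n : ℕ → ℕ, StrictMono n → (∀ j, 0 < n j) →
      Tendsto (fun j => f^[n j] z) atTop (𝓝 z) →
      Tendsto (fun j => ((F^[n j] zt).1 - zt.1) / (n j : ℝ)) atTop (𝓝 ρ)

open scoped unitInterval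

/-- A real function on a connected space whose values are integers is constant. -/
lemma pbr_int_const {X : Type*} [TopologicalSpace X] [PreconnectedSpace X] [Nonempty X]
    (g : X → ℝ) (hg : Continuous g) (h : ∀ x, ((g x : ℝ) : Circle1) = 0) :
    ∃ k : ℤ, ∀ x, g x = k := by
  obtain ⟨x0⟩ := ‹Nonempty X›
  have h0 := h x0
  rw [AddCircle.coe_eq_zero_iff] at h0
  obtain ⟨k, hk⟩ := h0
  refine ⟨k, fun x => ?_⟩
  have := (AddCircle.isCoveringMap_coe (1 : ℝ)).eq_of_comp_eq (A := X) (g₁ := g)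
    (g₂ := fun _ => g x0) hg continuous_const (by ext y; simp [h]) x0 rfl
  rw [this, ← hk]; simp

/-- The embedding of the strip in the complex plane. -/
noncomputable def pbrE (p : StripC) : ℂ := ⟨p.1, p.2⟩

lemma pbrE_cont : Continuous pbrE := by
  have : pbrE = fun p : StripC => ((p.1 : ℝ) : ℂ) + ((p.2 : ℝ) : ℂ) * Complex.I := by
    ext p; simp [pbrE, Complex.ext_iff]
  rw [this]; fun_prop

lemma pbrE_inj : Function.Injective pbrE := by
  intro p q h
  simp only [pbrE, Complex.mk.injEq] at h
  exact Prod.ext h.1 (Subtype.ext h.2)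

/-- The space of pairs of distinct points. -/
abbrev PbrConf : Type := {pq : StripC × StripC // pq.1 ≠ pq.2}

/-- Exchange of the two points of a pair. -/
def pbrSwap (a : PbrConf) : PbrConf := ⟨(a.1.2, a.1.1), a.2.symm⟩

lemma pbr_conf_log (G : I × StripC → StripC) (hG : Continuous G)
    (hinj : ∀ t p q, G (t, p) = G (t, q) → p = q) (h0 : ∀ p, G (0, p) = p) :
    ∃ w : PbrConf → ℂ, Continuous w ∧ (∀ a, w (pbrSwap a) = w a) ∧
      ∀ a : PbrConf, Complex.exp (w a) * (pbrE a.1.1 - pbrE a.1.2)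
        = pbrE (G (1, a.1.1)) - pbrE (G (1, a.1.2)) := by
  have hd : ∀ a : PbrConf, pbrE a.1.1 - pbrE a.1.2 ≠ 0 := fun a =>
    sub_ne_zero.mpr fun h => a.2 (pbrE_inj h)
  have hn : ∀ (t : I) (a : PbrConf), pbrE (G (t, a.1.1)) - pbrE (G (t, a.1.2)) ≠ 0 := fun t a =>
    sub_ne_zero.mpr fun h => a.2 (hinj t _ _ (pbrE_inj h))
  have hcE := pbrE_cont
  let r : C(I × PbrConf, {z : ℂ // z ≠ 0}) :=
    { toFun := fun ta => ⟨(pbrE (G (ta.1, ta.2.1.1)) - pbrE (G (ta.1, ta.2.1.2))) /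
        (pbrE ta.2.1.1 - pbrE ta.2.1.2), div_ne_zero (hn _ _) (hd _)⟩
      continuous_toFun := by
        refine Continuous.subtype_mk ?_ _
        refine Continuous.div ?_ ?_ (fun ta => hd ta.2)
        · fun_prop
        · fun_prop }
  have hr0 : ∀ a, r (0, a) = (⟨_, Complex.exp_ne_zero ((0 : C(PbrConf, ℂ)) a)⟩ : {z : ℂ // z ≠ 0}) := by
    intro a
    apply Subtype.ext
    simp [r, h0, div_self (hd a)]
  let cov := Complex.isCoveringMap_exp
  let W := cov.liftHomotopy r 0 hr0
  have hWl := cov.liftHomotopy_lifts r 0 hr0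
  have hW0 := cov.liftHomotopy_zero r 0 hr0
  have hsc : Continuous pbrSwap := by
    unfold pbrSwap; fun_prop
  refine ⟨fun a => W (1, a), by fun_prop, ?_, ?_⟩
  · have hsym : (fun ta : I × PbrConf => W (ta.1, pbrSwap ta.2)) = W := by
      refine (cov.eq_liftHomotopy_iff hr0 _).2 ⟨fun a => by fun_prop, ?_, fun a => hW0 _⟩
      funext ⟨t, a⟩
      have h1 := congrFun hWl (t, pbrSwap a)
      refine h1.trans ?_
      apply Subtype.ext
      simp only [r, pbrSwap, ContinuousMap.coe_mk]
      rw [← neg_sub (pbrE a.1.1) (pbrE a.1.2), ← neg_sub (pbrE (G (t, a.1.1))), neg_div_neg_eq]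
    intro a
    exact congrFun hsym (1, a)
  · intro a
    have h1 := congrArg Subtype.val (congrFun hWl (1, a))
    have h2 : Complex.exp (W (1, a)) = (pbrE (G (1, a.1.1)) - pbrE (G (1, a.1.2))) /
        (pbrE a.1.1 - pbrE a.1.2) := h1
    rw [h2, div_mul_cancel₀ _ (hd a)]

/-- Key lemma: a path from `p` to `S p` meets the fixed set of the involution `S`. -/
lemma pbr_key (c : ℝ) (F : StripC → StripC) (hF : Continuous F)
    (w : PbrConf → ℂ) (hw : Continuous w) (hsym : ∀ a, w (pbrSwap a) = w a)
    (hexp : ∀ a : PbrConf, Complex.exp (w a) * (pbrE a.1.1 - pbrE a.1.2)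
        = pbrE (F a.1.1) - pbrE (F a.1.2))
    (S : StripC → StripC) (hS : ∀ p, S p = (2 * c - (F p).1, (F p).2))
    (hSS : ∀ p, S (S p) = p)
    (γ : I → StripC) (hγ : Continuous γ) (h1 : γ 1 = S (γ 0)) : ∃ s, S (γ s) = γ s := by
  by_contra! hne
  have hSc : Continuous S := by
    have : S = fun p => (2 * c - (F p).1, (F p).2) := funext hS
    rw [this]; fun_prop
  have hcE := pbrE_cont
  have hES : ∀ p q, pbrE (S p) - pbrE (S q)
      = -(starRingEnd ℂ) (pbrE (F p) - pbrE (F q)) := by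
    intro p q
    rw [hS, hS]
    simp only [pbrE, Complex.ext_iff, Complex.sub_re, Complex.sub_im, Complex.neg_re,
      Complex.neg_im, Complex.conj_re, Complex.conj_im]
    constructor <;> ring
  let a : I → PbrConf := fun s => ⟨(γ s, S (γ s)), (hne s).symm⟩
  have ha : Continuous a := by
    refine Continuous.subtype_mk ?_ _
    fun_prop
  have hu0 : ∀ s, pbrE (γ s) - pbrE (S (γ s)) ≠ 0 := fun s =>
    sub_ne_zero.mpr fun h => hne s (pbrE_inj h).symm
  let u : C(I, {z : ℂ // z ≠ 0}) :=
    ⟨fun s => ⟨pbrE (γ s) - pbrE (S (γ s)), hu0 s⟩, by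
      refine Continuous.subtype_mk ?_ _
      fun_prop⟩
  let cov := Complex.isCoveringMap_exp
  have hl0 : u 0 = (⟨_, Complex.exp_ne_zero (Complex.log (u 0).1)⟩ : {z : ℂ // z ≠ 0}) :=
    Subtype.ext (Complex.exp_log (u 0).2).symm
  obtain ⟨θ, hθ, -⟩ := cov.exists_path_lifts u _ hl0
  have hθ' : ∀ s, Complex.exp (θ s) = pbrE (γ s) - pbrE (S (γ s)) := fun s =>
    congrArg Subtype.val (congrFun hθ s)
  let K : I → ℂ := fun s => θ s - (starRingEnd ℂ) (θ s) - (starRingEnd ℂ) (w (a s))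
  have hK : Continuous K := by
    have := Complex.continuous_conj
    fun_prop
  have hKexp : ∀ s, Complex.exp (K s) = 1 := by
    intro s
    have e1 := hES (γ s) (S (γ s))
    rw [hSS, ← hexp (a s)] at e1
    have e2 : Complex.exp (θ s)
        = (starRingEnd ℂ) (Complex.exp (w (a s)) * Complex.exp (θ s)) := by
      rw [hθ']
      exact (neg_sub _ _).symm.trans ((congrArg Neg.neg e1).trans (neg_neg _))
    rw [map_mul, ← Complex.exp_conj, ← Complex.exp_conj] at e2
    simp only [K]
    rw [Complex.exp_sub, Complex.exp_sub, e2]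
    field_simp
  have hconst := cov.eq_of_comp_eq (A := I) (g₁ := K) (g₂ := fun _ => K 0) hK continuous_const
    (by funext s; apply Subtype.ext; simp [hKexp]) 0 rfl
  have hK1 : K 1 = K 0 := congrFun hconst 1
  have ha1 : a 1 = pbrSwap (a 0) := by
    apply Subtype.ext
    simp [a, pbrSwap, h1, hSS]
  have hexp1 : Complex.exp (θ 1 - θ 0) = -1 := by
    have := hθ' 0
    rw [Complex.exp_sub, hθ', h1, hSS, this, div_eq_iff (hu0 0)]
    ring
  simp only [K, ha1, hsym] at hK1
  -- imaginary part of the difference vanishes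
  have him : (θ 1 - θ 0).im = 0 := by
    have := congrArg Complex.im hK1
    simp only [Complex.sub_im, Complex.conj_im] at this ⊢
    linarith
  have hre := congrArg Complex.re hexp1
  rw [Complex.exp_re, him, Real.cos_zero, mul_one] at hre
  have := Real.exp_pos (θ 1 - θ 0).re
  simp at hre
  simp at this
  linarith

lemma pbr_comm_int (F : StripC → StripC) (hcomm : ∀ p, F (deckC p) = deckC (F p)) :
    ∀ (n : ℤ) (p : StripC), F (p.1 + n, p.2) = ((F p).1 + n, (F p).2) := by
  have hnat : ∀ (n : ℕ) (p : StripC), F (p.1 + n, p.2) = ((F p).1 + n, (F p).2) := by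
    intro n
    induction n with
    | zero => intro p; simp
    | succ k ih =>
      intro p
      have := hcomm (p.1 + k, p.2)
      rw [ih] at this
      simp only [deckC] at this
      push_cast
      rw [← add_assoc, ← add_assoc, this]
  intro n p
  obtain ⟨k, rfl | rfl⟩ := n.eq_nat_or_neg
  · exact_mod_cast hnat k p
  · have := hnat k (p.1 + ((-(k : ℤ) : ℤ) : ℝ), p.2)
    simp only [Int.cast_neg, Int.cast_natCast, neg_add_cancel_right, Prod.mk.eta] at this ⊢
    rw [this]
    ext <;> simp

/-- Lifting the isotopy. -/
lemma pbr_lift_isotopy (f : AnnC → AnnC) (hiso : IsotopicToIdC f)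
    (F : StripC → StripC) (hF : Continuous F) (hlift : ∀ p, projC (F p) = f (projC p)) :
    ∃ G : I × StripC → StripC, Continuous G ∧ (∀ t p q, G (t, p) = G (t, q) → p = q) ∧
      (∀ p, G (0, p) = p) ∧ ∃ k : ℤ, ∀ p, G (1, p) = ((F p).1 + k, (F p).2) := by
  obtain ⟨H, hH, hH0, hH1, hHg⟩ := hiso
  have hpc : Continuous projC := by
    unfold projC
    exact (AddCircle.continuous_mk' (1 : ℝ)).comp continuous_fst |>.prodMk continuous_snd
  let cov := AddCircle.isCoveringMap_coe (1 : ℝ)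
  let h : C(I × StripC, Circle1) := ⟨fun tp => (H (tp.1, projC tp.2)).1, by fun_prop⟩
  let f0 : C(StripC, ℝ) := ⟨fun p => p.1, continuous_fst⟩
  have h0 : ∀ p, h (0, p) = ((f0 p : ℝ) : Circle1) := by
    intro p
    exact congrArg Prod.fst (hH0 (projC p))
  let W := cov.liftHomotopy h f0 h0
  have hWl : ∀ t p, ((W (t, p) : ℝ) : Circle1) = (H (t, projC p)).1 := fun t p =>
    congrFun (cov.liftHomotopy_lifts h f0 h0) (t, p)
  have hW0 : ∀ p, W (0, p) = p.1 := cov.liftHomotopy_zero h f0 h0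
  have hWn : ∀ (n : ℤ) t (p : StripC), W (t, (p.1 + n, p.2)) = W (t, p) + n := by
    intro n t p
    have hpn : ∀ p : StripC, projC (p.1 + n, p.2) = projC p := by
      intro p
      simp only [projC, Prod.mk.injEq, and_true]
      rw [AddCircle.coe_add]
      have : ((n : ℝ) : Circle1) = 0 := by
        rw [AddCircle.coe_eq_zero_iff]; exact ⟨n, by simp⟩
      rw [this, add_zero]
    have hu : (fun tp : I × StripC => W (tp.1, (tp.2.1 + (n : ℝ), tp.2.2)) - (n : ℝ)) = W := by
      refine (cov.eq_liftHomotopy_iff h0 _).2 ⟨fun a => by fun_prop, ?_, fun a => ?_⟩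
      · funext ⟨t, p⟩
        have e1 := hWl t (p.1 + n, p.2)
        rw [hpn] at e1
        have : ((n : ℝ) : Circle1) = 0 := by
          rw [AddCircle.coe_eq_zero_iff]; exact ⟨n, by simp⟩
        simp only [Function.comp, AddCircle.coe_sub, e1, this, sub_zero]
        rfl
      · simp only [hW0]
        simp [f0]
    have := congrFun hu (t, p)
    simp only at this
    linarith
  let G : I × StripC → StripC := fun tp => (W tp, (H (tp.1, projC tp.2)).2)
  have hGc : Continuous G := by fun_prop
  have hGp : ∀ t p, projC (G (t, p)) = H (t, projC p) := fun t p => Prod.ext (hWl t p) rfl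
  refine ⟨G, hGc, ?_, ?_, ?_⟩
  · intro t p q hpq
    obtain ⟨g, hg⟩ := hHg t
    have e1 := congrArg projC hpq
    rw [hGp, hGp, hg, hg] at e1
    have e2 := g.injective e1
    have e3 : ((q.1 - p.1 : ℝ) : Circle1) = 0 := by
      rw [AddCircle.coe_sub]
      have := congrArg Prod.fst e2
      simp only [projC] at this
      rw [this, sub_self]
    rw [AddCircle.coe_eq_zero_iff] at e3
    obtain ⟨n, hn⟩ := e3
    have hq : q = (p.1 + n, p.2) := by
      refine Prod.ext ?_ (congrArg Prod.snd e2).symm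
      simp at hn ⊢
      linarith
    have e4 : W (t, p) = W (t, q) := congrArg Prod.fst hpq
    rw [hq, hWn] at e4
    have : (n : ℝ) = 0 := by linarith
    rw [hq, this, add_zero]
  · intro p
    refine Prod.ext (hW0 p) ?_
    have := congrArg Prod.snd (hH0 (projC p))
    exact this
  · have hpe : ∀ p, projC (G (1, p)) = projC (F p) := by
      intro p
      rw [hGp, hlift]
      exact hH1 _
    obtain ⟨k, hk⟩ := pbr_int_const (fun p : StripC => (G (1, p)).1 - (F p).1) (by fun_prop) (by
      intro p
      have := congrArg Prod.fst (hpe p)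
      simp only [projC] at this
      rw [AddCircle.coe_sub, this, sub_self])
    refine ⟨k, fun p => Prod.ext ?_ ?_⟩
    · have := hk p
      simp only at this ⊢
      linarith
    · have := congrArg Prod.snd (hpe p)
      exact this

/-- The lifted reverser is an involution. -/
lemma pbr_invol (f : AnnC ≃ₜ AnnC) (hrev : ∀ z, f (RC z) = RC (f.symm z))
    (F : StripC ≃ₜ StripC) (hlift : ∀ p, projC (F p) = f (projC p))
    (hcomm : ∀ p, F (deckC p) = deckC (F p)) (c : ℝ) (m : ℤ) (hm : 2 * c = m)
    (S : StripC → StripC) (hS : ∀ p, S p = (2 * c - (F p).1, (F p).2)) :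
    ∀ p, S (S p) = p := by
  have hSc : Continuous S := by
    have : S = fun p => (2 * c - (F p).1, (F p).2) := funext hS
    rw [this]; fun_prop
  have hpS : ∀ p, projC (S p) = RC (f (projC p)) := by
    intro p
    rw [← hlift, hS, hm]
    simp only [projC, RC, Prod.mk.injEq, and_true]
    have : ((m : ℝ) : Circle1) = 0 := by
      rw [AddCircle.coe_eq_zero_iff]; exact ⟨m, by simp⟩
    rw [AddCircle.coe_sub, this, zero_sub]
  have hpSS : ∀ p, projC (S (S p)) = projC p := by
    intro p
    rw [hpS, hpS, hrev]
    simp [RC]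
  have hFn := pbr_comm_int F hcomm
  obtain ⟨k, hk⟩ := pbr_int_const (fun p : StripC => (S (S p)).1 - p.1) (by fun_prop) (by
      intro p
      have := congrArg Prod.fst (hpSS p)
      simp only [projC] at this
      rw [AddCircle.coe_sub, this, sub_self])
  have hk' : ∀ p, S (S p) = (p.1 + k, p.2) := by
    intro p
    have h2 := congrArg Prod.snd (hpSS p)
    refine Prod.ext ?_ h2
    have := hk p
    simp only at this ⊢
    linarith
  have hk0 : (k : ℝ) = 0 := by
    let p : StripC := (0, 0)
    have e1 := hk' (S p)
    rw [hk' p, hS (p.1 + k, p.2), hFn, hS p] at e1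
    have := congrArg Prod.fst e1
    simp only at this
    linarith
  intro p
  rw [hk', hk0, add_zero]

lemma pbr_axis (f : AnnC ≃ₜ AnnC) (hiso : IsotopicToIdC f)
    (hrev : ∀ z, f (RC z) = RC (f.symm z))
    (F : StripC ≃ₜ StripC) (hlift : ∀ p, projC (F p) = f (projC p))
    (hcomm : ∀ p, F (deckC p) = deckC (F p)) (c : ℝ) (m : ℤ) (hm : 2 * c = m)
    (hno : ¬ ∃ y : I, 0 < (y : ℝ) ∧ (y : ℝ) < 1 ∧ F (c, y) = (c, y)) :
    (∀ y : I, (F (c, y)).1 ≤ c) ∨ (∀ y : I, c ≤ (F (c, y)).1) := by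
  obtain ⟨G, hG, hGinj, hG0, k, hGk⟩ := pbr_lift_isotopy f hiso F F.continuous hlift
  obtain ⟨w, hw, hwsym, hwexp⟩ := pbr_conf_log G hG hGinj hG0
  have hexp : ∀ a : PbrConf, Complex.exp (w a) * (pbrE a.1.1 - pbrE a.1.2)
        = pbrE (F a.1.1) - pbrE (F a.1.2) := by
    intro a
    rw [hwexp, hGk, hGk]
    simp [pbrE, Complex.ext_iff]
  let S : StripC → StripC := fun p => (2 * c - (F p).1, (F p).2)
  have hS : ∀ p, S p = (2 * c - (F p).1, (F p).2) := fun p => rfl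
  have hSS := pbr_invol f hrev F hlift hcomm c m hm S hS
  have hfix : ∀ y : I, S (c, y) = (c, y) → F (c, y) = (c, y) := by
    intro y h
    have e1 := congrArg Prod.fst h
    have e2 := congrArg Prod.snd h
    simp only [S] at e1 e2
    exact Prod.ext (by simp only; linarith) e2
  have hne : ∀ y : I, 0 < (y : ℝ) → (y : ℝ) < 1 → (F (c, y)).1 ≠ c := by
    intro y hy0 hy1 hFc
    set y' : I := (F (c, y)).2 with hy'
    have hSy : S (c, y) = (c, y') := by
      rw [hS]
      refine Prod.ext ?_ rfl
      simp only [hFc]; ring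
    have hyI := y.2
    have hyI' := y'.2
    let γ : I → StripC := fun s => (c, ⟨(1 - (s : ℝ)) * y + s * y', by
      have := s.2.1; have := s.2.2
      constructor
      · have := mul_nonneg (sub_nonneg.2 s.2.2) hyI.1
        have := mul_nonneg s.2.1 hyI'.1
        linarith
      · have := mul_le_mul_of_nonneg_left hyI.2 (sub_nonneg.2 s.2.2)
        have := mul_le_mul_of_nonneg_left hyI'.2 s.2.1
        linarith⟩)
    have hγ : Continuous γ := by
      refine continuous_const.prodMk (Continuous.subtype_mk ?_ _)
      fun_prop
    have hγ0 : γ 0 = (c, y) := by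
      refine Prod.ext rfl (Subtype.ext ?_); simp [γ]
    have hγ1 : γ 1 = (c, y') := by
      refine Prod.ext rfl (Subtype.ext ?_); simp [γ]
    obtain ⟨s, hs⟩ := pbr_key c F F.continuous w hw hwsym hexp S hS hSS γ hγ
      (by rw [hγ0, hγ1, hSy])
    by_cases hs1 : s = 1
    · rw [hs1, hγ1, ← hSy, hSS, hSy] at hs
      have := hfix y (hSy.trans hs.symm)
      exact hno ⟨y, hy0, hy1, this⟩
    · have hslt : (s : ℝ) < 1 := lt_of_le_of_ne s.2.2 fun h => hs1 (Subtype.ext h)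
      refine hno ⟨(γ s).2, ?_, ?_, hfix _ hs⟩
      · have := mul_pos (sub_pos.2 hslt) hy0
        have := mul_nonneg s.2.1 hyI'.1
        simp only [γ]; linarith
      · have := mul_lt_mul_of_pos_left hy1 (sub_pos.2 hslt)
        have := mul_le_mul_of_nonneg_left hyI'.2 s.2.1
        simp only [γ]; linarith
  -- constant sign on the open segment, then closure
  let φ : ℝ → ℝ := fun y => (F (c, Set.projIcc 0 1 zero_le_one y)).1
  have hφ : Continuous φ := by
    have := continuous_projIcc (h := zero_le_one' ℝ)
    fun_prop
  have hφI : ∀ y : I, φ y = (F (c, y)).1 := fun y => by simp [φ]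
  have hφne : ∀ y ∈ Set.Ioo (0 : ℝ) 1, φ y ≠ c := by
    intro y hy
    have := hne ⟨y, hy.1.le, hy.2.le⟩ hy.1 hy.2
    rwa [← hφI] at this
  have hcl : ∀ y : I, (y : ℝ) ∈ closure (Set.Ioo (0 : ℝ) 1) := by
    intro y
    rw [closure_Ioo (by norm_num)]
    exact y.2
  have hdich : (∀ y ∈ Set.Ioo (0 : ℝ) 1, φ y ≤ c) ∨ (∀ y ∈ Set.Ioo (0 : ℝ) 1, c ≤ φ y) := by
    by_contra! hcon
    obtain ⟨⟨y1, hy1, h1⟩, ⟨y2, hy2, h2⟩⟩ := hcon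
    obtain ⟨y, hy, hyc⟩ := isPreconnected_Ioo.intermediate_value hy2 hy1 hφ.continuousOn
      ⟨h2.le, h1.le⟩
    exact hφne y hy hyc
  rcases hdich with h | h
  · left
    intro y
    rw [← hφI]
    exact closure_minimal (s := Set.Ioo (0 : ℝ) 1) (t := {y | φ y ≤ c}) h
      (isClosed_le hφ continuous_const) (hcl y)
  · right
    intro y
    rw [← hφI]
    exact closure_minimal (s := Set.Ioo (0 : ℝ) 1) (t := {y | c ≤ φ y}) h
      (isClosed_le continuous_const hφ) (hcl y)

lemma pbr_left (F : StripC ≃ₜ StripC) (hcomm : ∀ p, F (deckC p) = deckC (F p)) (c : ℝ)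
    (h : ∀ y : I, (F (c, y)).1 ≤ c) : ∀ p, p.1 ≤ c → (F p).1 ≤ c := by
  intro p hp
  by_contra! hlt
  have hpre : IsPreconnected (Set.Ioi c ×ˢ (Set.univ : Set I)) :=
    isPreconnected_Ioi.prod isPreconnected_univ
  have him := hpre.image F.symm F.symm.continuous.continuousOn
  obtain ⟨n, hn⟩ := exists_nat_gt (|c - (F (c, 0)).1|)
  have hn' := (le_abs_self _).trans_lt hn
  have e := pbr_comm_int F hcomm n (c, 0)
  obtain ⟨q, ⟨r, hr, rfl⟩, hq⟩ := him.intermediate_value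
    (f := fun q : StripC => q.1) (a := p) (b := (c + n, 0))
    ⟨F p, ⟨hlt, trivial⟩, by simp⟩
    ⟨F (c + n, 0), ⟨by
      simp only [Int.cast_natCast] at e
      rw [e]; simp only [Set.mem_Ioi]; linarith, trivial⟩, by simp⟩
    continuous_fst.continuousOn (show c ∈ Set.Icc p.1 (c + n) from ⟨hp, by simp⟩)
  have h1 := h (F.symm r).2
  have h2 : F (c, (F.symm r).2) = r := by
    have : (c, (F.symm r).2) = F.symm r := Prod.ext hq.symm rfl
    rw [this]; simp
  rw [h2] at h1
  exact absurd hr.1 (not_lt.2 h1)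

lemma pbr_right (F : StripC ≃ₜ StripC) (hcomm : ∀ p, F (deckC p) = deckC (F p)) (c : ℝ)
    (h : ∀ y : I, c ≤ (F (c, y)).1) : ∀ p, c ≤ p.1 → c ≤ (F p).1 := by
  intro p hp
  by_contra! hlt
  have hpre : IsPreconnected (Set.Iio c ×ˢ (Set.univ : Set I)) :=
    isPreconnected_Iio.prod isPreconnected_univ
  have him := hpre.image F.symm F.symm.continuous.continuousOn
  obtain ⟨n, hn⟩ := exists_nat_gt (|(F (c, 0)).1 - c|)
  have hn' := (le_abs_self _).trans_lt hn
  have e := pbr_comm_int F hcomm (-n) (c, 0)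
  obtain ⟨q, ⟨r, hr, rfl⟩, hq⟩ := him.intermediate_value
    (f := fun q : StripC => q.1) (b := p) (a := (c + -n, 0))
    ⟨F (c + -n, 0), ⟨by
      simp only [Int.cast_neg, Int.cast_natCast] at e
      rw [e]; simp only [Set.mem_Iio]; linarith, trivial⟩, by simp⟩
    ⟨F p, ⟨hlt, trivial⟩, by simp⟩
    continuous_fst.continuousOn (show c ∈ Set.Icc (c + -n) p.1 from ⟨by simp, hp⟩)
  have h1 := h (F.symm r).2
  have h2 : F (c, (F.symm r).2) = r := by
    have : (c, (F.symm r).2) = F.symm r := Prod.ext hq.symm rfl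
    rw [this]; simp
  rw [h2] at h1
  exact absurd hr.1 (not_lt.2 h1)

lemma pbr_seq (f : AnnC → AnnC) (z : AnnC) (h : PosRecurrentC f z) :
    ∃ n : ℕ → ℕ, StrictMono n ∧ (∀ j, 0 < n j) ∧ Tendsto (fun j => f^[n j] z) atTop (𝓝 z) := by
  have hc : MapClusterPt z atTop (fun n => f^[n] z) := by
    rw [mapClusterPt_iff_frequently]
    intro U hU
    rw [frequently_atTop]
    intro N
    exact h U hU N
  obtain ⟨ψ, hψ, ht⟩ := MapClusterPt.tendsto_subseq hc
  refine ⟨fun j => ψ (j + 1), fun a b hab => hψ (by omega), fun j => ?_, ?_⟩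
  · exact lt_of_le_of_lt (Nat.zero_le _) (hψ (Nat.lt_succ_self j))
  · exact ht.comp (tendsto_add_atTop_nat 1)

lemma pbr_surj (z : AnnC) : ∃ p, projC p = z := by
  obtain ⟨x, hx⟩ := QuotientAddGroup.mk_surjective z.1
  exact ⟨(x, z.2), Prod.ext hx rfl⟩

lemma pbr_rot_nonpos (f : AnnC → AnnC) (F : StripC → StripC)
    (hcomm : ∀ p, F (deckC p) = deckC (F p)) (c : ℝ)
    (h : ∀ p, p.1 ≤ c → (F p).1 ≤ c) (z : AnnC) (hz : PosRecurrentC f z) (ρ : ℝ)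
    (hρ : HasRotNumC f F z ρ) : ρ ≤ 0 := by
  obtain ⟨n, hn, hn0, ht⟩ := pbr_seq f z hz
  obtain ⟨p, hp⟩ := pbr_surj z
  obtain ⟨m, hm⟩ := exists_int_gt (p.1 - c)
  have hstep : ∀ q : StripC, q.1 ≤ c + m → (F q).1 ≤ c + m := by
    intro q hq
    have h1 := h (q.1 + ((-m : ℤ) : ℝ), q.2) (by push_cast; linarith)
    rw [pbr_comm_int F hcomm] at h1
    push_cast at h1
    linarith
  have hit : ∀ j, (F^[j] p).1 ≤ c + m := by
    intro j
    induction j with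
    | zero => simp only [Function.iterate_zero, id]; linarith
    | succ j ih => rw [Function.iterate_succ_apply']; exact hstep _ ih
  have hlim := hρ p hp n hn hn0 ht
  have hcast : Tendsto (fun j => (n j : ℝ)) atTop atTop :=
    tendsto_natCast_atTop_atTop.comp hn.tendsto_atTop
  have h0 : Tendsto (fun j => (c + m - p.1) / (n j : ℝ)) atTop (𝓝 0) :=
    tendsto_const_nhds.div_atTop hcast
  refine le_of_tendsto_of_tendsto' hlim h0 fun j => ?_
  have := hit (n j)
  gcongr

lemma pbr_rot_nonneg (f : AnnC → AnnC) (F : StripC → StripC)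
    (hcomm : ∀ p, F (deckC p) = deckC (F p)) (c : ℝ)
    (h : ∀ p, c ≤ p.1 → c ≤ (F p).1) (z : AnnC) (hz : PosRecurrentC f z) (ρ : ℝ)
    (hρ : HasRotNumC f F z ρ) : 0 ≤ ρ := by
  obtain ⟨n, hn, hn0, ht⟩ := pbr_seq f z hz
  obtain ⟨p, hp⟩ := pbr_surj z
  obtain ⟨m, hm⟩ := exists_int_lt (p.1 - c)
  have hstep : ∀ q : StripC, c + m ≤ q.1 → c + m ≤ (F q).1 := by
    intro q hq
    have h1 := h (q.1 + ((-m : ℤ) : ℝ), q.2) (by push_cast; linarith)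
    rw [pbr_comm_int F hcomm] at h1
    push_cast at h1
    linarith
  have hit : ∀ j, c + m ≤ (F^[j] p).1 := by
    intro j
    induction j with
    | zero => simp only [Function.iterate_zero, id]; linarith
    | succ j ih => rw [Function.iterate_succ_apply']; exact hstep _ ih
  have hlim := hρ p hp n hn hn0 ht
  have hcast : Tendsto (fun j => (n j : ℝ)) atTop atTop :=
    tendsto_natCast_atTop_atTop.comp hn.tendsto_atTop
  have h0 : Tendsto (fun j => (c + m - p.1) / (n j : ℝ)) atTop (𝓝 0) :=
    tendsto_const_nhds.div_atTop hcast
  refine le_of_tendsto_of_tendsto' h0 hlim fun j => ?_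
  have := hit (n j)
  gcongr

/-- Poincaré–Birkhoff type theorem for reversible homeomorphisms: if a
reversible homeomorphism of the closed annulus isotopic to the identity has,
for a lift `F`, positively recurrent points of rotation numbers `ρ⁻ < 0 < ρ⁺`,
then it has two distinct symmetric interior fixed points of zero rotation
number, one on each symmetry axis. -/
theorem pb_reversible (f : AnnC ≃ₜ AnnC) (hiso : IsotopicToIdC f)
    (hrev : ∀ z, f (RC z) = RC (f.symm z))
    (F : StripC ≃ₜ StripC) (hlift : ∀ p, projC (F p) = f (projC p))
    (hcomm : ∀ p, F (deckC p) = deckC (F p))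
    (z₁ z₂ : AnnC) (hrec₁ : PosRecurrentC f z₁) (hrec₂ : PosRecurrentC f z₂)
    (ρm ρp : ℝ) (hρ₁ : HasRotNumC f F z₁ ρm) (hρ₂ : HasRotNumC f F z₂ ρp)
    (hneg : ρm < 0) (hpos : 0 < ρp) :
    ∃ w₁ w₂ : AnnC, w₁ ≠ w₂ ∧
      f w₁ = w₁ ∧ f w₂ = w₂ ∧
      RC w₁ = w₁ ∧ RC w₂ = w₂ ∧
      w₁.1 = ((0 : ℝ) : Circle1) ∧ w₂.1 = ((1/2 : ℝ) : Circle1) ∧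
      (0 : ℝ) < w₁.2 ∧ (w₁.2 : ℝ) < 1 ∧ (0 : ℝ) < w₂.2 ∧ (w₂.2 : ℝ) < 1 ∧
      (∃ wt₁ : StripC, projC wt₁ = w₁ ∧ F wt₁ = wt₁) ∧
      (∃ wt₂ : StripC, projC wt₂ = w₂ ∧ F wt₂ = wt₂) := by
  have main : ∀ (c : ℝ) (m : ℤ), 2 * c = m →
      ∃ y : I, 0 < (y : ℝ) ∧ (y : ℝ) < 1 ∧ F (c, y) = (c, y) := by
    intro c m hm
    by_contra hno
    rcases pbr_axis f hiso hrev F hlift hcomm c m hm hno with h | h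
    · have := pbr_rot_nonpos f F hcomm c (pbr_left F hcomm c h) z₂ hrec₂ ρp hρ₂
      linarith
    · have := pbr_rot_nonneg f F hcomm c (pbr_right F hcomm c h) z₁ hrec₁ ρm hρ₁
      linarith
  obtain ⟨y₁, h10, h11, hF1⟩ := main 0 0 (by simp)
  obtain ⟨y₂, h20, h21, hF2⟩ := main (1/2) 1 (by norm_num)
  have hhalf : ((1/2 : ℝ) : Circle1) ≠ ((0 : ℝ) : Circle1) := by
    intro h
    rw [AddCircle.coe_zero, AddCircle.coe_eq_zero_iff] at h
    obtain ⟨n, hn⟩ := h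
    simp only [zsmul_eq_mul, mul_one] at hn
    have h2 : ((2 * n : ℤ) : ℝ) = ((1 : ℤ) : ℝ) := by push_cast; linarith
    have h3 : 2 * n = 1 := by exact_mod_cast h2
    omega
  have hnegh : -((1/2 : ℝ) : Circle1) = ((1/2 : ℝ) : Circle1) := by
    rw [neg_eq_iff_add_eq_zero, ← AddCircle.coe_add, AddCircle.coe_eq_zero_iff]
    exact ⟨1, by norm_num⟩
  refine ⟨projC (0, y₁), projC (1/2, y₂), ?_, ?_, ?_, ?_, ?_, rfl, rfl, h10, h11, h20, h21,
    ⟨_, rfl, hF1⟩, ⟨_, rfl, hF2⟩⟩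
  · intro h
    exact hhalf (congrArg Prod.fst h).symm
  · rw [← hlift, hF1]
  · rw [← hlift, hF2]
  · simp [RC, projC]
  · exact Prod.ext hnegh rfl
end

section
/- Let f be a reversible homeomorphism of the closed annulus A = (ℝ/ℤ) × [0,1] that is isotopic to the identity, and let F be a lift of f to ℝ × [0,1] commuting with T(x,y) = (x+1,y). Suppose there exist positively recurrent points z₁, z₂ of f having rotation numbers ρ⁻ < ρ⁺ for F. Then for every rational number p/q ∈ (ρ⁻, ρ⁺) written in irreducible form with q ≥ 1, there exists a symmetric periodic point z of f of minimal period q admitting a lift z̃ with F^[q](z̃) = z̃ + (p, 0) (a symmetric q-prime-periodic orbit of rotation number p/q). -/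
open MeasureTheory Filter Topology

namespace PBaux

open unitInterval

/-- Reflection on the strip. -/
def reflS : StripC → StripC := fun z => (-z.1, z.2)

/-- Horizontal translation on the strip. -/
def trS (a : ℝ) : StripC → StripC := fun z => (z.1 + a, z.2)

lemma reflS_reflS (z : StripC) : reflS (reflS z) = z := by simp [reflS]

lemma trS_trS (a b : ℝ) (z : StripC) : trS a (trS b z) = trS (b + a) z := by
  simp [trS, add_assoc]

lemma reflS_trS (a : ℝ) (z : StripC) : reflS (trS a z) = trS (-a) (reflS z) := by
  simp [trS, reflS]; ring

@[simp] lemma trS_fst (a : ℝ) (z : StripC) : (trS a z).1 = z.1 + a := rfl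

@[simp] lemma trS_snd (a : ℝ) (z : StripC) : (trS a z).2 = z.2 := rfl

lemma trS_zero (z : StripC) : trS 0 z = z := by simp [trS]

lemma continuous_trS (a : ℝ) : Continuous (trS a) := by unfold trS; fun_prop

lemma continuous_reflS : Continuous reflS := by unfold reflS; fun_prop

lemma const_of_int {X : Type*} [TopologicalSpace X] [PreconnectedSpace X] (g : X → ℝ)
    (hg : Continuous g) (h : ∀ x, ∃ n : ℤ, g x = n) (x y : X) : g x = g y := by
  choose n hn using h
  have hc : Continuous n := by
    rw [Int.isClosedEmbedding_coe_real.isInducing.continuous_iff]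
    convert hg using 1
    ext x; simp [hn]
  rw [hn, hn, PreconnectedSpace.constant ‹_› hc (x := x) (y := y)]

lemma projC_eq_iff (z w : StripC) : projC z = projC w ↔ ∃ k : ℤ, w = trS k z := by
  unfold projC
  rw [Prod.mk.injEq, eq_comm, ← sub_eq_zero, ← AddCircle.coe_sub, AddCircle.coe_eq_zero_iff]
  constructor
  · rintro ⟨⟨n, hn⟩, h⟩
    refine ⟨n, Prod.ext ?_ h.symm⟩
    simp at hn ⊢; linarith
  · rintro ⟨k, rfl⟩
    exact ⟨⟨k, by simp⟩, rfl⟩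

lemma projC_trS (k : ℤ) (z : StripC) : projC (trS k z) = projC z :=
  ((projC_eq_iff _ _).2 ⟨k, rfl⟩).symm

lemma projC_reflS (z : StripC) : projC (reflS z) = RC (projC z) := by
  simp [projC, reflS, RC]

lemma continuous_projC : Continuous projC := by
  unfold projC
  exact ((AddCircle.continuous_mk' (1:ℝ)).comp continuous_fst).prodMk continuous_snd

lemma deck_eq (z : StripC) : deckC z = trS 1 z := rfl

lemma comm_int {F : StripC → StripC} (h : ∀ z, F (trS 1 z) = trS 1 (F z)) (k : ℤ) (z : StripC) :
    F (trS k z) = trS k (F z) := by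
  induction k using Int.induction_on generalizing z with
  | zero => simp [trS_zero]
  | succ n ih =>
    have : trS ((n + 1 : ℤ) : ℝ) z = trS 1 (trS (n : ℤ) z) := by rw [trS_trS]; push_cast; rfl
    rw [this, h, ih, trS_trS]; push_cast; rfl
  | pred n ih =>
    have h1 : trS (((-n - 1 : ℤ)) : ℝ) z = trS ((-n : ℤ) : ℝ) (trS (-1) z) := by
      rw [trS_trS]; push_cast; ring_nf
    have h2 : F (trS (-1) z) = trS (-1) (F z) := by
      have := h (trS (-1) z)
      rw [trS_trS] at this
      simp only [neg_add_cancel, trS_zero] at this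
      rw [this, trS_trS]; simp [trS_zero]
    rw [h1, ih, h2, trS_trS]; push_cast; ring_nf

lemma iter_comm {F : StripC → StripC} {a : ℝ} (h : ∀ z, F (trS a z) = trS a (F z)) (n : ℕ)
    (z : StripC) : F^[n] (trS a z) = trS a (F^[n] z) := by
  induction n generalizing z with
  | zero => rfl
  | succ n ih => simp only [Function.iterate_succ, Function.comp_apply, h, ih]

/-! ### The winding lemma -/

lemma circle_exp_const {X : Type*} [TopologicalSpace X] [PreconnectedSpace X] (g : X → ℝ)
    (hg : Continuous g) (h : ∀ x y, Circle.exp (g x) = Circle.exp (g y)) (x y : X) :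
    g x = g y := by
  have := const_of_int (fun u => (g u - g y) / (2 * Real.pi)) (by fun_prop) (by
    intro u
    obtain ⟨m, hm⟩ := Circle.exp_eq_exp.1 (h u y)
    refine ⟨m, ?_⟩
    rw [hm]; field_simp; ring) x y
  have hp := Real.pi_pos
  field_simp at this
  linarith

lemma winding (Φ : I × I → ℂ) (hc : Continuous Φ) (h0 : ∀ x, Φ x ≠ 0)
    (h1 : ∀ t, Φ (t, 1) = - Φ (t, 0))
    (h2 : ∀ s, Φ (1, s) = (starRingEnd ℂ) (Φ (0, s))) : False := by
  let u : C(I × I, Circle) := ⟨fun x => ⟨Φ x / ‖Φ x‖, by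
    have := norm_ne_zero_iff.2 (h0 x)
    rw [Submonoid.unitSphere, Submonoid.mem_mk, Subsemigroup.mem_mk, mem_sphere_zero_iff_norm]
    simp [this]⟩, by
    refine Continuous.subtype_mk ?_ _
    refine hc.div (by fun_prop) fun x => ?_
    exact_mod_cast norm_ne_zero_iff.2 (h0 x)⟩
  have hu : ∀ x, (u x : ℂ) = Φ x / ‖Φ x‖ := fun x => rfl
  obtain ⟨e, he⟩ := Circle.exp_surjective (u (0, 0))
  let γ : C(I, Circle) := u.comp ((ContinuousMap.const I 0).prodMk (ContinuousMap.id I))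
  let g := Circle.isCoveringMap_exp.liftPath γ e he.symm
  have hg : ∀ s, Circle.exp (g s) = u (0, s) := fun s =>
    congrFun (Circle.isCoveringMap_exp.liftPath_lifts γ e he.symm) s
  let L := Circle.isCoveringMap_exp.liftHomotopy u g (fun s => (hg s).symm)
  have hL : ∀ x, Circle.exp (L x) = u x := fun x =>
    congrFun (Circle.isCoveringMap_exp.liftHomotopy_lifts u g (fun s => (hg s).symm)) x
  have hLc : Continuous L := L.continuous
  have k1 : ∀ t, u (t, 1) = u (t, 0) * Circle.exp Real.pi := by
    intro t
    ext
    rw [Circle.coe_mul, hu, hu, h1]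
    simp [neg_div]
  have k2 : ∀ s, u (1, s) * u (0, s) = 1 := by
    intro s
    ext
    rw [Circle.coe_mul, hu, hu, h2]
    have := norm_ne_zero_iff.2 (h0 (0, s))
    have h3 : (‖Φ (0, s)‖ : ℂ) ≠ 0 := by exact_mod_cast this
    simp only [RCLike.norm_conj, Circle.coe_one]
    field_simp
    rw [mul_comm, Complex.mul_conj, Complex.normSq_eq_norm_sq]
    push_cast; rfl
  have e1 : ∀ t, Circle.exp (L (t, 1) - L (t, 0)) = Circle.exp Real.pi := by
    intro t
    rw [Circle.exp_sub, hL, hL, k1]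
    simp
  have a1 := circle_exp_const (fun t : I => L (t, 1) - L (t, 0)) (by fun_prop)
    (fun x y => by simp only [e1]) 1 0
  have a2 := circle_exp_const (fun s : I => L (1, s) + L (0, s)) (by fun_prop)
    (fun x y => by simp only [Circle.exp_add, hL, k2]) 1 0
  have a3 : L (0, 1) - L (0, 0) = 0 := by
    linarith
  have := e1 0
  rw [a3] at this
  have h4 := congrArg (fun z : Circle => (z : ℂ)) this
  simp at h4
  norm_num [Complex.ext_iff] at h4

/-! ### Lifting the isotopy -/

lemma lift_isotopy (f : AnnC → AnnC) (hiso : IsotopicToIdC f)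
    (F : StripC → StripC) (hFc : Continuous F) (hlift : ∀ p, projC (F p) = f (projC p)) :
    ∃ P : I → StripC → StripC, Continuous (fun x : I × StripC => P x.1 x.2) ∧
      (∀ t, Function.Injective (P t)) ∧ (∀ z, P 0 z = z) ∧
      (∀ t (k : ℤ) z, P t (trS k z) = trS k (P t z)) ∧
      ∃ k : ℤ, ∀ z, F z = trS k (P 1 z) := by
  obtain ⟨H, Hc, H0, H1, Hh⟩ := hiso
  let h : C(I × StripC, Circle1) := ⟨fun x => (H (x.1, projC x.2)).1, by
    have := continuous_projC
    fun_prop⟩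
  have cov := AddCircle.isCoveringMap_coe (1 : ℝ)
  let f0 : C(StripC, ℝ) := ⟨fun z => z.1, continuous_fst⟩
  have hh0 : ∀ z, h (0, z) = ((f0 z : ℝ) : Circle1) := by
    intro z
    change (H (0, projC z)).1 = _
    have : H (0, projC z) = projC z := H0 _
    rw [this]; rfl
  let L := cov.liftHomotopy h f0 hh0
  have hL : ∀ x, ((L x : ℝ) : Circle1) = h x := fun x =>
    congrFun (cov.liftHomotopy_lifts h f0 hh0) x
  have hL0 : ∀ z, L (0, z) = z.1 := fun z => cov.liftHomotopy_zero h f0 hh0 z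
  have hLc : Continuous L := L.continuous
  let P : I → StripC → StripC := fun t z => (L (t, z), (H (t, projC z)).2)
  have hPc : Continuous (fun x : I × StripC => P x.1 x.2) := by
    have := continuous_projC
    change Continuous (fun x : I × StripC => (L (x.1, x.2), (H (x.1, projC x.2)).2))
    fun_prop
  have hPp : ∀ t z, projC (P t z) = H (t, projC z) := fun t z =>
    Prod.ext (hL (t, z)) rfl
  have hP0 : ∀ z, P 0 z = z := by
    intro z
    refine Prod.ext (hL0 z) ?_
    change (H (0, projC z)).2 = z.2
    have : H (0, projC z) = projC z := H0 _
    rw [this]; rfl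
  have hPk : ∀ t (k : ℤ) z, P t (trS k z) = trS k (P t z) := by
    intro t k z
    have hk : ∀ t, ∃ n : ℤ, (P t (trS k z)).1 - (P t z).1 = n := by
      intro t
      have : projC (P t z) = projC (P t (trS k z)) := by rw [hPp, hPp, projC_trS]
      obtain ⟨n, hn⟩ := (projC_eq_iff _ _).1 this
      exact ⟨n, by rw [hn]; simp⟩
    have hc : Continuous fun t => (P t (trS k z)).1 - (P t z).1 := by
      change Continuous fun t => L (t, trS k z) - L (t, z)
      fun_prop
    have := const_of_int _ hc hk t 0
    rw [hP0, hP0] at this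
    refine Prod.ext ?_ ?_
    · simp at this ⊢; linarith
    · change (H (t, projC (trS k z))).2 = (H (t, projC z)).2
      rw [projC_trS]
  refine ⟨P, hPc, ?_, hP0, hPk, ?_⟩
  · intro t z w hzw
    obtain ⟨g, hg⟩ := Hh t
    have h1 : projC z = projC w := by
      apply g.injective
      rw [← hg, ← hg, ← hPp, ← hPp, hzw]
    obtain ⟨k, rfl⟩ := (projC_eq_iff _ _).1 h1
    rw [hPk] at hzw
    have := congrArg Prod.fst hzw
    simp at this
    simp [this, trS_zero]
  · have hk : ∀ z, ∃ n : ℤ, F z = trS n (P 1 z) := by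
      intro z
      apply (projC_eq_iff _ _).1
      rw [hPp, hlift]
      exact H1 _
    have hP1 : Continuous (P 1) := hPc.comp (by fun_prop : Continuous fun z : StripC => ((1 : I), z))
    have hc : Continuous fun z => (F z).1 - (P 1 z).1 := by fun_prop
    have hcst := const_of_int _ hc (fun z => by
      obtain ⟨n, hn⟩ := hk z
      exact ⟨n, by rw [hn]; simp⟩)
    obtain ⟨n, hn⟩ := hk (0, 0)
    refine ⟨n, fun z => ?_⟩
    obtain ⟨m, hm⟩ := hk z
    have h1 := hcst z (0, 0)
    rw [hn, hm] at h1
    simp at h1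
    rw [hm, h1]

lemma lift_isotopy_iter (f : AnnC → AnnC) (hiso : IsotopicToIdC f)
    (F : StripC → StripC) (hFc : Continuous F) (hlift : ∀ p, projC (F p) = f (projC p)) (q : ℕ) :
    ∃ P : I → StripC → StripC, Continuous (fun x : I × StripC => P x.1 x.2) ∧
      (∀ t, Function.Injective (P t)) ∧ (∀ z, P 0 z = z) ∧
      ∃ c : ℝ, ∀ z, F^[q] z = trS c (P 1 z) := by
  obtain ⟨P, hPc, hinj, h0, hk, k, hF⟩ := lift_isotopy f hiso F hFc hlift
  refine ⟨fun t => (P t)^[q], ?_, fun t => (hinj t).iterate q, ?_, q * k, ?_⟩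
  · induction q with
    | zero => exact continuous_snd
    | succ n ih =>
      simp only [Function.iterate_succ', Function.comp_apply]
      exact hPc.comp (continuous_fst.prodMk ih)
  · intro z
    exact Function.iterate_fixed (h0 z) q
  · intro z
    induction q with
    | zero => simp [trS_zero]
    | succ n ih =>
      simp only [Function.iterate_succ', Function.comp_apply]
      rw [ih, hF]
      have := hk 1 (n * k) ((P 1)^[n] z)
      push_cast at this
      rw [this, trS_trS]
      push_cast; ring_nf

/-! ### Reversibility of the lift -/

lemma rev_lift (f : AnnC ≃ₜ AnnC) (hrev : ∀ z, f (RC z) = RC (f.symm z))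
    (F : StripC → StripC) (hFc : Continuous F) (hlift : ∀ p, projC (F p) = f (projC p))
    (hcomm : ∀ (k : ℤ) z, F (trS k z) = trS k (F z)) (z : StripC) :
    F (reflS (F z)) = reflS z := by
  have hk : ∀ z, ∃ n : ℤ, F (reflS (F z)) = trS n (reflS z) := by
    intro z
    apply (projC_eq_iff _ _).1
    rw [hlift, projC_reflS, projC_reflS, hlift, hrev]
    simp
  have hc : Continuous fun z => (F (reflS (F z))).1 - (reflS z).1 := by
    have := continuous_reflS
    fun_prop
  have hcst := const_of_int _ hc (fun z => by
    obtain ⟨n, hn⟩ := hk z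
    exact ⟨n, by rw [hn]; simp⟩)
  obtain ⟨n, hn⟩ := hk z
  have hn2 : ∀ w, F (reflS (F w)) = trS n (reflS w) := by
    intro w
    obtain ⟨m, hm⟩ := hk w
    have h1 := hcst w z
    rw [hn, hm] at h1
    simp at h1
    rw [hm, h1]
  have h2 := hn2 (reflS (F z))
  rw [hn2 z, reflS_trS, reflS_reflS, reflS_reflS] at h2
  have h3 := hcomm (-n) z
  push_cast at h3
  rw [h3] at h2
  have h4 := congrArg Prod.fst h2
  simp at h4
  have h5 : (n : ℝ) = 0 := by linarith
  rw [hn, h5, trS_zero]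

lemma rev_iter (F : StripC → StripC) (h : ∀ z, F (reflS (F z)) = reflS z) (n : ℕ) (z : StripC) :
    F^[n] (reflS (F^[n] z)) = reflS z := by
  induction n generalizing z with
  | zero => rfl
  | succ n ih =>
    rw [Function.iterate_succ_apply' F n (reflS _), Function.iterate_succ_apply F n z, ih, h]

/-! ### No fixed point on the line implies disjointness from the line -/

/-- The strip as a subset of the plane. -/
def toC (z : StripC) : ℂ := ⟨z.1, z.2⟩

lemma continuous_toC : Continuous toC := by
  have : toC = fun z => ((z.1 : ℂ) + ((z.2 : ℝ) : ℂ) * Complex.I) := by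
    ext z; apply Complex.ext <;> simp [toC]
  rw [this]
  fun_prop

lemma toC_inj {z w : StripC} (h : toC z = toC w) : z = w := by
  have h1 := congrArg Complex.re h
  have h2 := congrArg Complex.im h
  exact Prod.ext h1 (Subtype.ext h2)

lemma disjoint_line (G : StripC → StripC) (hGc : Continuous G)
    (hrev : ∀ z, G (reflS (G z)) = reflS z)
    (P : I → StripC → StripC) (hPc : Continuous (fun x : I × StripC => P x.1 x.2))
    (hinj : ∀ t, Function.Injective (P t)) (hP0 : ∀ z, P 0 z = z)
    (c : ℝ) (hP1 : ∀ z, G z = trS c (P 1 z))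
    (hfix : ∀ y, G (0, y) ≠ (0, y)) (y : I) : (G (0, y)).1 ≠ 0 := by
  intro hy
  set y' := (G (0, y)).2 with hy'
  have hGy : G (0, y) = (0, y') := Prod.ext hy rfl
  have hr : ∀ w : I, reflS (0, w) = (0, w) := fun w => by simp [reflS]
  have hGy' : G (0, y') = (0, y) := by
    have := hrev (0, y)
    rwa [hGy, hr, hr] at this
  haveI : PathConnectedSpace I := isPathConnected_iff_pathConnectedSpace.1
    ((convex_Icc (0 : ℝ) 1).isPathConnected ⟨0, by simp⟩)
  let pth : Path y y' := (PathConnectedSpace.joined y y').somePath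
  let Z : I → StripC := fun s => (0, pth s)
  let W : I → StripC := fun s => reflS (G (Z s))
  have hZc : Continuous Z := by
    have := pth.continuous
    fun_prop
  have hWc : Continuous W := continuous_reflS.comp (hGc.comp hZc)
  have hZ0 : Z 0 = (0, y) := by simp [Z]
  have hZ1 : Z 1 = (0, y') := by simp [Z]
  have hW0 : W 0 = (0, y') := by simp only [W, hZ0, hGy, hr]
  have hW1 : W 1 = (0, y) := by simp only [W, hZ1, hGy', hr]
  refine winding (fun x => toC (P x.1 (Z x.2)) - toC (P x.1 (W x.2))) ?_ ?_ ?_ ?_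
  · refine Continuous.sub ?_ ?_
    · exact continuous_toC.comp (hPc.comp (continuous_fst.prodMk (hZc.comp continuous_snd)))
    · exact continuous_toC.comp (hPc.comp (continuous_fst.prodMk (hWc.comp continuous_snd)))
  · rintro ⟨t, s⟩ h
    have h1 : Z s = W s := hinj t (toC_inj (sub_eq_zero.1 h))
    apply hfix (pth s)
    have h2 := congrArg reflS h1
    simp only [W, reflS_reflS] at h2
    rw [← hr (pth s)]
    conv_lhs => rw [hr]
    exact h2.symm
  · intro t
    simp only [hZ0, hZ1, hW0, hW1]
    ring
  · intro s
    simp only [hP0]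
    have e1 : trS c (P 1 (Z s)) = reflS (W s) := by
      rw [← hP1]; simp only [W, reflS_reflS]
    have e2 : trS c (P 1 (W s)) = reflS (Z s) := by
      rw [← hP1]; simp only [W, hrev]
    have e3 : P 1 (Z s) = trS (-c) (reflS (W s)) := by
      rw [← e1, trS_trS]; simp [trS_zero]
    have e4 : P 1 (W s) = trS (-c) (reflS (Z s)) := by
      rw [← e2, trS_trS]; simp [trS_zero]
    rw [e3, e4]
    apply Complex.ext <;> simp [toC, reflS, trS] <;> ring

/-! ### Trapping -/

lemma trap (G : StripC → StripC) (hGc : Continuous G)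
    (hrev : ∀ z, G (reflS (G z)) = reflS z)
    (hcomm : ∀ (k : ℤ) z, G (trS k z) = trS k (G z))
    (hne : ∀ y, (G (0, y)).1 ≠ 0) :
    (∀ (k : ℤ) (z : StripC), z.1 ≤ (k : ℝ) → (G z).1 ≤ (k : ℝ)) ∨ (∀ (k : ℤ) z, (k : ℝ) ≤ z.1 → (k : ℝ) ≤ (G z).1) := by
  have hr : ∀ w : I, reflS (0, w) = (0, w) := fun w => by simp [reflS]
  have hcv : Continuous fun y : I => (G (0, y)).1 := by fun_prop
  have hpre : ∀ z, (G z).1 = 0 → z = reflS (G (0, (G z).2)) := by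
    intro z hz
    have h1 : G z = (0, (G z).2) := Prod.ext hz rfl
    have := congrArg reflS (hrev z)
    rw [h1, hr, reflS_reflS] at this
    exact this.symm
  have hch : ∀ y : I, Continuous fun x : ℝ => (G (x, y)).1 := fun y => by fun_prop
  have hsign : (∀ y, (G (0, y)).1 < 0) ∨ (∀ y, 0 < (G (0, y)).1) := by
    by_contra! hcon
    obtain ⟨⟨a, ha⟩, b, hb⟩ := hcon
    obtain ⟨y, hy⟩ := mem_range_of_exists_le_of_exists_ge hcv ⟨b, hb⟩ ⟨a, ha⟩
    exact hne y hy
  rcases hsign with hs | hs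
  · left
    have base : ∀ z, z.1 ≤ 0 → (G z).1 ≤ 0 := by
      intro z hz
      by_contra! hpos
      obtain ⟨N, hN⟩ := exists_nat_gt (G z).1
      have hle : z.1 - N ≤ z.1 := by simp
      have hG : (G (z.1 - N, z.2)).1 ≤ 0 := by
        have := congrArg Prod.fst (hcomm (-N) z)
        simp [trS] at this
        rw [← sub_eq_add_neg] at this
        rw [this]; linarith
      obtain ⟨x, hx, hx0⟩ := intermediate_value_Icc hle (hch z.2).continuousOn
        (show (0 : ℝ) ∈ Set.Icc _ _ from ⟨hG, hpos.le⟩)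
      have h1 := congrArg Prod.fst (hpre (x, z.2) hx0)
      have h2 := hs (G (x, z.2)).2
      simp only [reflS] at h1
      have := hx.2
      linarith
    intro k z hz
    have h1 := base (trS (-k : ℤ) z) (by simp; linarith)
    rw [hcomm] at h1
    simp at h1
    linarith
  · right
    have base : ∀ z, 0 ≤ z.1 → 0 ≤ (G z).1 := by
      intro z hz
      by_contra! hpos
      obtain ⟨N, hN⟩ := exists_nat_gt (-(G z).1)
      have hle : z.1 ≤ z.1 + N := by simp
      have hG : 0 ≤ (G (z.1 + N, z.2)).1 := by
        have := congrArg Prod.fst (hcomm N z)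
        simp [trS] at this
        rw [this]; linarith
      obtain ⟨x, hx, hx0⟩ := intermediate_value_Icc hle (hch z.2).continuousOn
        (show (0 : ℝ) ∈ Set.Icc _ _ from ⟨hpos.le, hG⟩)
      have h1 := congrArg Prod.fst (hpre (x, z.2) hx0)
      have h2 := hs (G (x, z.2)).2
      simp only [reflS] at h1
      have := hx.1
      linarith
    intro k z hz
    have h1 := base (trS (-k : ℤ) z) (by simp; linarith)
    rw [hcomm] at h1
    simp at h1
    linarith

/-! ### Rotation number estimates -/

lemma bdd_disp (F : StripC → StripC) (hFc : Continuous F)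
    (hcomm : ∀ (k : ℤ) z, F (trS k z) = trS k (F z)) :
    ∃ C : ℝ, ∀ z, |(F z).1 - z.1| ≤ C := by
  have hK : IsCompact ((Set.Icc (0:ℝ) 1) ×ˢ (Set.univ : Set I)) := isCompact_Icc.prod isCompact_univ
  obtain ⟨C, hC⟩ := hK.exists_bound_of_continuousOn (f := fun z : StripC => (F z).1 - z.1)
    (by fun_prop)
  refine ⟨C, fun z => ?_⟩
  have h1 : z = trS ⌊z.1⌋ (Int.fract z.1, z.2) := by
    simp [trS]
  have h2 := hC (Int.fract z.1, z.2) ⟨⟨Int.fract_nonneg _, (Int.fract_lt_one _).le⟩, trivial⟩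
  have h3 := congrArg F h1
  rw [hcomm] at h3
  have h4 := congrArg Prod.fst h3
  rw [Real.norm_eq_abs] at h2
  simp only [trS_fst] at h4
  have h5 : (F z).1 - z.1 = (F (Int.fract z.1, z.2)).1 - Int.fract z.1 := by
    rw [h4]
    have := Int.floor_add_fract z.1
    linarith
  rw [h5]
  exact h2

lemma bdd_iter (F : StripC → StripC) (C : ℝ) (hC : ∀ z, |(F z).1 - z.1| ≤ C) (n : ℕ) (z : StripC) :
    |(F^[n] z).1 - z.1| ≤ n * C := by
  induction n with
  | zero => simp
  | succ n ih =>
    rw [Function.iterate_succ_apply']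
    have := hC (F^[n] z)
    rw [abs_le] at *
    push_cast
    constructor <;> linarith [this.1, this.2, ih.1, ih.2]

lemma iter_G (F : StripC → StripC) (hcomm : ∀ (k : ℤ) z, F (trS k z) = trS k (F z))
    (p : ℤ) (q i : ℕ) (z : StripC) :
    F^[q * i] z = trS (p * i) ((fun w => trS (-p) (F^[q] w))^[i] z) := by
  induction i with
  | zero => simp [trS_zero]
  | succ i ih =>
    rw [Nat.mul_succ, Nat.add_comm, Function.iterate_add_apply, ih, Function.iterate_succ_apply']
    have := iter_comm (hcomm (p * i)) q ((fun w => trS (-p) (F^[q] w))^[i] z)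
    push_cast at this
    rw [this, trS_trS]
    push_cast; ring_nf

lemma main_est (F : StripC → StripC) (hFc : Continuous F)
    (hcomm : ∀ (k : ℤ) z, F (trS k z) = trS k (F z)) (p : ℤ) (q : ℕ) (hq : 1 ≤ q) (z : StripC) :
    ∃ K : ℝ, ∀ n : ℕ, |(F^[n] z).1 - ((fun w => trS (-p) (F^[q] w))^[n / q] z).1
      - n * (p / q : ℝ)| ≤ K := by
  obtain ⟨C, hC⟩ := bdd_disp F hFc hcomm
  have hC0 : 0 ≤ C := (abs_nonneg _).trans (hC z)
  refine ⟨q * C + |(p : ℝ)|, fun n => ?_⟩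
  have hn : n = n % q + q * (n / q) := (Nat.mod_add_div n q).symm
  have hlt : n % q < q := Nat.mod_lt _ hq
  set r := n % q
  set i := n / q
  have h1 := bdd_iter F C hC r (F^[q * i] z)
  rw [← Function.iterate_add_apply, ← hn] at h1
  conv at h1 => lhs; rw [iter_G F hcomm p q i z]
  have hrC : (r : ℝ) * C ≤ q * C := by gcongr
  have hq0 : (0 : ℝ) < q := by exact_mod_cast hq
  have hnr : (n : ℝ) = r + q * i := by exact_mod_cast hn
  have h2 : (n : ℝ) * (p / q) = p * i + p * (r / q) := by
    rw [hnr]; field_simp; ring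
  have h3 : |(p : ℝ) * (r / q)| ≤ |(p : ℝ)| := by
    rw [abs_mul]
    have h4 : |(r : ℝ) / q| ≤ 1 := by
      rw [abs_of_nonneg (by positivity), div_le_one hq0]
      exact_mod_cast hlt.le
    nlinarith [abs_nonneg (p : ℝ)]
  rw [h2]
  simp only [trS_fst] at h1
  have h5 := abs_le.1 h1
  have h6 := abs_le.1 h3
  rw [abs_le]
  constructor <;> linarith [h5.1, h5.2, h6.1, h6.2]

lemma exists_seq (f : AnnC → AnnC) (z : AnnC) (h : PosRecurrentC f z) :
    ∃ n : ℕ → ℕ, StrictMono n ∧ (∀ j, 0 < n j) ∧ Tendsto (fun j => f^[n j] z) atTop (𝓝 z) := by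
  have hcl : MapClusterPt z atTop (fun n => f^[n] z) := by
    rw [mapClusterPt_iff_frequently]
    intro U hU
    rw [Filter.frequently_atTop]
    exact h U hU
  obtain ⟨ψ, hψ, ht⟩ := hcl.tendsto_subseq
  refine ⟨fun j => ψ (j + 1), fun a b hab => hψ (by omega), fun j => ?_,
    ht.comp (tendsto_add_atTop_nat 1)⟩
  exact lt_of_lt_of_le (Nat.succ_pos j) (hψ.le_apply (x := j + 1))

lemma projC_surj (z : AnnC) : ∃ zt, projC zt = z := by
  obtain ⟨x, hx⟩ := QuotientAddGroup.mk_surjective z.1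
  exact ⟨(x, z.2), Prod.ext hx rfl⟩

lemma rot_le (f : AnnC → AnnC) (F : StripC → StripC) (z : AnnC) (h : PosRecurrentC f z)
    (ρ a : ℝ) (hρ : HasRotNumC f F z ρ)
    (hb : ∀ zt, ∃ K, ∀ n : ℕ, (F^[n] zt).1 - zt.1 ≤ n * a + K) : ρ ≤ a := by
  obtain ⟨n, hn, hn0, ht⟩ := exists_seq f z h
  obtain ⟨zt, hzt⟩ := projC_surj z
  obtain ⟨K, hK⟩ := hb zt
  have h1 := hρ zt hzt n hn hn0 ht
  have h2 : Tendsto (fun j => a + K / (n j : ℝ)) atTop (𝓝 (a + 0)) :=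
    tendsto_const_nhds.add
      ((tendsto_const_div_atTop_nhds_zero_nat K).comp hn.tendsto_atTop)
  rw [add_zero] at h2
  refine le_of_tendsto_of_tendsto' h1 h2 fun j => ?_
  have : (0 : ℝ) < n j := by exact_mod_cast hn0 j
  rw [div_le_iff₀ this]
  have h3 := hK (n j)
  field_simp
  linarith

lemma le_rot (f : AnnC → AnnC) (F : StripC → StripC) (z : AnnC) (h : PosRecurrentC f z)
    (ρ a : ℝ) (hρ : HasRotNumC f F z ρ)
    (hb : ∀ zt, ∃ K, ∀ n : ℕ, n * a - K ≤ (F^[n] zt).1 - zt.1) : a ≤ ρ := by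
  obtain ⟨n, hn, hn0, ht⟩ := exists_seq f z h
  obtain ⟨zt, hzt⟩ := projC_surj z
  obtain ⟨K, hK⟩ := hb zt
  have h1 := hρ zt hzt n hn hn0 ht
  have h2 : Tendsto (fun j => a - K / (n j : ℝ)) atTop (𝓝 (a - 0)) :=
    tendsto_const_nhds.sub
      ((tendsto_const_div_atTop_nhds_zero_nat K).comp hn.tendsto_atTop)
  rw [sub_zero] at h2
  refine le_of_tendsto_of_tendsto' h2 h1 fun j => ?_
  have : (0 : ℝ) < n j := by exact_mod_cast hn0 j
  rw [le_div_iff₀ this]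
  have h3 := hK (n j)
  field_simp
  linarith

lemma iter_le (G : StripC → StripC) (S : StripC → Prop) (h : ∀ z, S z → S (G z)) (n : ℕ)
    (z : StripC) (hz : S z) : S (G^[n] z) := by
  induction n with
  | zero => exact hz
  | succ n ih => rw [Function.iterate_succ_apply']; exact h _ ih

end PBaux
/-- Poincaré–Birkhoff type corollary for reversible homeomorphisms: if a
reversible homeomorphism of the closed annulus isotopic to the identity has,
for a lift `F`, positively recurrent points of rotation numbers `ρ⁻ < ρ⁺`, then
for every irreducible rational `p/q ∈ (ρ⁻, ρ⁺)` there is a symmetric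
`q`-prime-periodic point of rotation number `p/q`. -/
theorem pb_reversible_corollary (f : AnnC ≃ₜ AnnC) (hiso : IsotopicToIdC f)
    (hrev : ∀ z, f (RC z) = RC (f.symm z))
    (F : StripC ≃ₜ StripC) (hlift : ∀ p, projC (F p) = f (projC p))
    (hcomm : ∀ p, F (deckC p) = deckC (F p))
    (z₁ z₂ : AnnC) (hrec₁ : PosRecurrentC f z₁) (hrec₂ : PosRecurrentC f z₂)
    (ρm ρp : ℝ) (hρ₁ : HasRotNumC f F z₁ ρm) (hρ₂ : HasRotNumC f F z₂ ρp)
    (hlt : ρm < ρp) :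
    ∀ p : ℤ, ∀ q : ℕ, 1 ≤ q → Int.gcd p (q : ℤ) = 1 →
      ρm < (p : ℝ) / (q : ℝ) → (p : ℝ) / (q : ℝ) < ρp →
      ∃ z : AnnC, (∃ j : ℕ, RC z = (⇑f)^[j] z) ∧
        Function.minimalPeriod (⇑f) z = q ∧
        ∃ zt : StripC, projC zt = z ∧ (⇑F)^[q] zt = (zt.1 + (p : ℝ), zt.2) := by
  intro p q hq hgcd hlo hhi
  have hc : ∀ (k : ℤ) z, F (PBaux.trS k z) = PBaux.trS k (F z) := PBaux.comm_int hcomm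
  have hFr := PBaux.rev_lift f hrev F F.continuous hlift hc
  have hPr := PBaux.rev_iter F hFr q
  set G : StripC → StripC := fun w => PBaux.trS (-p) ((⇑F)^[q] w) with hG
  have hqc : ∀ (k : ℤ) z, (⇑F)^[q] (PBaux.trS k z) = PBaux.trS k ((⇑F)^[q] z) :=
    fun k z => PBaux.iter_comm (hc k) q z
  have hGc : Continuous G := (PBaux.continuous_trS _).comp (F.continuous.iterate q)
  have hGcomm : ∀ (k : ℤ) z, G (PBaux.trS k z) = PBaux.trS k (G z) := by
    intro k z
    simp only [hG]
    rw [hqc, PBaux.trS_trS, PBaux.trS_trS, add_comm]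
  have hGrev : ∀ z, G (PBaux.reflS (G z)) = PBaux.reflS z := by
    intro z
    simp only [hG]
    rw [PBaux.reflS_trS, neg_neg, hqc, PBaux.trS_trS, hPr]
    simp [PBaux.trS_zero]
  obtain ⟨P, hPc, hPinj, hP0, c, hP1⟩ :=
    PBaux.lift_isotopy_iter f hiso F F.continuous hlift q
  have hex : ∃ y, G (0, y) = (0, y) := by
    by_contra! hfix
    have hne := PBaux.disjoint_line G hGc hGrev P hPc hPinj hP0 (c + -p) (fun z => by
      simp only [hG]; rw [hP1, PBaux.trS_trS]) hfix
    rcases PBaux.trap G hGc hGrev hGcomm hne with ht | ht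
    · apply absurd hhi
      rw [not_lt]
      refine PBaux.rot_le f F z₂ hrec₂ ρp _ hρ₂ fun zt => ?_
      obtain ⟨K, hK⟩ := PBaux.main_est F F.continuous hc p q hq zt
      refine ⟨K + ⌈zt.1⌉ - zt.1, fun n => ?_⟩
      have h1 := (abs_le.1 (hK n)).2
      have h2 := PBaux.iter_le G (fun z => z.1 ≤ (⌈zt.1⌉ : ℤ)) (ht _) (n / q) zt (Int.le_ceil _)
      simp only [hG] at h2
      linarith
    · apply absurd hlo
      rw [not_lt]
      refine PBaux.le_rot f F z₁ hrec₁ ρm _ hρ₁ fun zt => ?_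
      obtain ⟨K, hK⟩ := PBaux.main_est F F.continuous hc p q hq zt
      refine ⟨K - ⌊zt.1⌋ + zt.1, fun n => ?_⟩
      have h1 := (abs_le.1 (hK n)).1
      have h2 := PBaux.iter_le G (fun z => ((⌊zt.1⌋ : ℤ) : ℝ) ≤ z.1) (ht _) (n / q) zt
        (Int.floor_le _)
      simp only [hG] at h2
      linarith
  obtain ⟨y, hy⟩ := hex
  have hFq : (⇑F)^[q] (0, y) = PBaux.trS p (0, y) := by
    rw [← hy]
    simp only [hG]
    rw [PBaux.trS_trS, neg_add_cancel, PBaux.trS_zero]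
    have h0 := hy
    simp only [hG] at h0
    rw [h0]
  have hiter : ∀ (n : ℕ) z, projC ((⇑F)^[n] z) = (⇑f)^[n] (projC z) := by
    intro n
    induction n with
    | zero => intro z; rfl
    | succ n ih =>
      intro z
      rw [Function.iterate_succ_apply', Function.iterate_succ_apply', hlift, ih]
  have hper : Function.IsPeriodicPt f q (projC (0, y)) := by
    change (⇑f)^[q] _ = _
    rw [← hiter, hFq, PBaux.projC_trS]
  refine ⟨projC (0, y), ⟨0, ?_⟩, ?_, (0, y), rfl, hFq⟩
  · rw [← PBaux.projC_reflS]
    simp [PBaux.reflS]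
  · obtain ⟨l, hl⟩ := hper.minimalPeriod_dvd
    set m := Function.minimalPeriod f (projC (0, y)) with hm
    have h1 : projC (0, y) = projC ((⇑F)^[m] (0, y)) := by
      rw [hiter]
      exact (Function.isPeriodicPt_minimalPeriod f _).symm
    obtain ⟨k, hk⟩ := (PBaux.projC_eq_iff _ _).1 h1
    have h2 := PBaux.iter_G F hc k m l (0, y)
    rw [← hl, hFq] at h2
    have h3 : (fun w => PBaux.trS (-k) ((⇑F)^[m] w)) (0, y) = (0, y) := by
      change PBaux.trS (-k) ((⇑F)^[m] (0, y)) = (0, y)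
      rw [hk, PBaux.trS_trS]; simp [PBaux.trS_zero]
    rw [Function.iterate_fixed h3 l] at h2
    have h4 := congrArg Prod.fst h2
    simp only [PBaux.trS_fst, zero_add] at h4
    have h5 : p = k * l := by exact_mod_cast h4
    have h6 : (l : ℤ) ∣ Int.gcd p q := by
      apply Int.dvd_coe_gcd
      · exact ⟨k, by rw [h5, mul_comm]⟩
      · exact ⟨m, by rw [hl]; push_cast; ring⟩
    rw [hgcd] at h6
    have h7 : l = 1 := by
      have : l ∣ 1 := by exact_mod_cast h6
      exact Nat.dvd_one.1 this
    rw [h7, mul_one] at hl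
    exact hl.symm
end

section
/- Let f be a homeomorphism of the open annulus A = (ℝ/ℤ) × (0,1) that is isotopic to the identity and preserves a finite area. Then f satisfies the intersection property: for every essential simple closed curve C ⊂ A (the image of an injective continuous loop that is not null-homotopic in A), one has C ∩ f(C) ≠ ∅. -/
open MeasureTheory Filter Topology

/-- A preconnected set meeting an open set `V` but not its frontier lies inside `V`. -/
theorem preconn_subset_of_frontier {X : Type*} [TopologicalSpace X] {s V : Set X}
    (hs : IsPreconnected s) (hV : IsOpen V) (hne : (s ∩ V).Nonempty)
    (hfr : ∀ x ∈ s, x ∉ frontier V) : s ⊆ V := by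
  refine hs.subset_left_of_subset_union hV (isClosed_closure (s := V)).isOpen_compl ?_ ?_ hne
  · exact Set.disjoint_left.2 fun x hx hx' => hx' (subset_closure hx)
  · intro x hx
    by_cases h : x ∈ closure V
    · left
      by_contra hxV
      exact hfr x hx ⟨h, by rwa [hV.interior_eq]⟩
    · exact Or.inr h

/-- Along an isotopy, the set of times at which the image of an open set contains `p` is open. -/
theorem isOpen_times {T X : Type*} [TopologicalSpace T] [TopologicalSpace X] [T2Space X]
    [LocallyCompactSpace X] [LocallyConnectedSpace X] (H : T × X → X) (hH : Continuous H)
    (hg : ∀ t, ∃ g : X ≃ₜ X, ∀ z, H (t, z) = g z) (L : Set X) (hL : IsOpen L) (p : X) :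
    IsOpen {t | ∃ q ∈ L, H (t, q) = p} := by
  rw [isOpen_iff_mem_nhds]
  rintro t₀ ⟨q, hq, hqp⟩
  obtain ⟨K, hK, hqK, hKL⟩ := exists_compact_subset hL hq
  have hVo : IsOpen (interior K) := isOpen_interior
  have hclo : closure (interior K) ⊆ K := closure_minimal interior_subset hK.isClosed
  have hFc : IsCompact (frontier (interior K)) :=
    hK.of_isClosed_subset isClosed_frontier (frontier_subset_closure.trans hclo)
  have hev : ∀ᶠ w : T × X in 𝓝 (t₀, p), ∀ k ∈ frontier (interior K), H (w.1, k) ≠ w.2 := by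
    apply hFc.eventually_forall_of_forall_eventually
    intro k hk
    have hne : H (t₀, k) ≠ p := by
      obtain ⟨g, hg'⟩ := hg t₀
      intro h
      rw [← hqp, hg', hg'] at h
      have := g.injective h
      subst this
      rw [hVo.frontier_eq] at hk
      exact hk.2 hqK
    have hc1 : Continuous fun z : (T × X) × X => H (z.1.1, z.2) := by fun_prop
    have hc2 : Continuous fun z : (T × X) × X => z.1.2 := by fun_prop
    exact (isOpen_ne_fun hc1 hc2).mem_nhds hne
  rw [nhds_prod_eq] at hev
  obtain ⟨A, hA, B, hB, hAB⟩ := Filter.mem_prod_iff.1 hev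
  obtain ⟨N, ⟨hNo, hpN, hNc⟩, hNB⟩ :=
    (LocallyConnectedSpace.open_connected_basis p).mem_iff.1 hB
  have hqN : ∀ᶠ t in 𝓝 t₀, H (t, q) ∈ N := by
    have hc : Continuous fun t => H (t, q) := by fun_prop
    exact (hNo.preimage hc).mem_nhds (by simpa [hqp] using hpN)
  filter_upwards [hA, hqN] with t htA htN
  obtain ⟨g, hg'⟩ := hg t
  have hsub : g ⁻¹' N ⊆ interior K := by
    apply preconn_subset_of_frontier _ hVo ⟨q, _, hqK⟩
    · intro x hx hxf
      have := hAB (show ((t, g x) : T × X) ∈ A ×ˢ B from ⟨htA, hNB hx⟩) x hxf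
      exact this (hg' x)
    · exact g.isPreconnected_preimage.2 hNc.isPreconnected
    · simpa [hg'] using htN
  refine ⟨g.symm p, hKL (interior_subset (hsub ?_)), ?_⟩
  · simpa using hpN
  · rw [hg', Homeomorph.apply_symm_apply]

/-- The main area argument for one complementary component. -/
theorem area_argument {T X : Type*} [TopologicalSpace T] [PreconnectedSpace T]
    [TopologicalSpace X] [T2Space X] [LocallyCompactSpace X] [LocallyConnectedSpace X]
    [PreconnectedSpace X] [MeasurableSpace X] [BorelSpace X] (H : T × X → X) (hH : Continuous H)
    (hg : ∀ t, ∃ g : X ≃ₜ X, ∀ z, H (t, z) = g z) (a b : T) (ha : ∀ z, H (a, z) = z)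
    (f : X ≃ₜ X) (hb : ∀ z, H (b, z) = f z) (μ : Measure X) (hfin : μ Set.univ < ⊤)
    (hpos : ∀ U : Set X, IsOpen U → U.Nonempty → 0 < μ U) (hf : MeasurePreserving f μ μ)
    (C : Set X) (hC : IsCompact C) (hCc : IsConnected C) (p : X)
    (hp : ∀ t, ∀ c ∈ C, H (t, c) ≠ p) (hdisj : ∀ c ∈ C, f c ∉ C)
    (hdisjL : ∀ c ∈ C, f c ∉ connectedComponentIn Cᶜ p) : False := by
  set L := connectedComponentIn Cᶜ p with hLdef
  have hCo : IsOpen Cᶜ := hC.isClosed.isOpen_compl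
  have hLo : IsOpen L := hCo.connectedComponentIn
  have hpC : p ∈ Cᶜ := fun h => hp a p h (ha p)
  have hpL : p ∈ L := mem_connectedComponentIn hpC
  have hLC : L ⊆ Cᶜ := connectedComponentIn_subset _ _
  have hMo : IsOpen (Cᶜ \ L) := by
    rw [isOpen_iff_mem_nhds]
    intro x hx
    refine Filter.mem_of_superset ((hCo.connectedComponentIn (x := x)).mem_nhds
      (mem_connectedComponentIn hx.1)) ?_
    intro y hy
    refine ⟨connectedComponentIn_subset _ _ hy, fun hyL => hx.2 ?_⟩
    have h1 := connectedComponentIn_eq hy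
    have h2 := connectedComponentIn_eq hyL
    rw [hLdef, h2, ← h1]
    exact mem_connectedComponentIn hx.1
  have hclL : closure L ⊆ L ∪ C := by
    intro x hx
    by_contra hcon
    rw [Set.mem_union, not_or] at hcon
    obtain ⟨y, hy, hyL⟩ := mem_closure_iff.1 hx _ hMo ⟨hcon.2, hcon.1⟩
    exact hy.2 hyL
  have hfrL : frontier L ⊆ C := by
    intro x hx
    rw [hLo.frontier_eq] at hx
    exact (hclL hx.1).resolve_left hx.2
  have hall : {t : T | ∃ q ∈ L, H (t, q) = p} = Set.univ := by
    refine IsClopen.eq_univ ⟨?_, isOpen_times H hH hg L hLo p⟩ ⟨a, p, hpL, ha p⟩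
    have : {t : T | ∃ q ∈ L, H (t, q) = p} = {t : T | ∃ q ∈ Cᶜ \ L, H (t, q) = p}ᶜ := by
      ext t
      obtain ⟨g, hg'⟩ := hg t
      constructor
      · rintro ⟨q, hq, hqp⟩ ⟨q', hq', hqp'⟩
        rw [← hqp, hg', hg'] at hqp'
        have := g.injective hqp'
        subst this
        exact hq'.2 hq
      · intro h
        by_contra hcon
        refine h ⟨g.symm p, ⟨fun hc => hp t _ hc (by simp [hg']), fun hc => hcon ?_⟩, by simp [hg']⟩
        exact ⟨_, hc, by simp [hg']⟩
    rw [this]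
    exact (isOpen_times H hH hg _ hMo p).isClosed_compl
  have hpf : p ∈ f '' L := by
    obtain ⟨q, hq, hqp⟩ := (hall ▸ Set.mem_univ b : b ∈ {t : T | ∃ q ∈ L, H (t, q) = p})
    exact ⟨q, hq, by rw [← hb, hqp]⟩
  have hfLo : IsOpen (f '' L) := f.isOpenMap _ hLo
  have hfrf : frontier (f '' L) ⊆ f '' C := by
    rw [← f.image_frontier]
    exact Set.image_mono hfrL
  obtain ⟨c₀, hc₀⟩ := hCc.nonempty
  have hfr_ne : (frontier L).Nonempty :=
    nonempty_frontier_iff.2 ⟨⟨p, hpL⟩, fun h => hLC (h ▸ Set.mem_univ c₀ : c₀ ∈ L) hc₀⟩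
  obtain ⟨z, hz⟩ := hfr_ne
  have hTc : IsPreconnected (closure L ∪ C) :=
    IsPreconnected.union z (frontier_subset_closure hz) (hfrL hz)
      isPreconnected_connectedComponentIn.closure hCc.isPreconnected
  have hTsub : closure L ∪ C ⊆ f '' L := by
    apply preconn_subset_of_frontier hTc hfLo ⟨p, Or.inl (subset_closure hpL), hpf⟩
    intro x hx hxf
    obtain ⟨c, hc, rfl⟩ := hfrf hxf
    have hx' : f c ∈ L ∪ C := hx.elim (fun h => hclL h) Or.inr
    exact hx'.elim (hdisjL c hc) (hdisj c hc)
  have hμ : μ (f '' L) = μ L := by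
    have := hf.measure_preimage hfLo.measurableSet.nullMeasurableSet
    rwa [Set.preimage_image_eq _ f.injective, eq_comm] at this
  have hLfin : μ L ≠ ⊤ := ((measure_mono (Set.subset_univ L)).trans_lt hfin).ne
  have hnull : μ (f '' L \ L) = 0 := by
    rw [measure_sdiff ((subset_closure.trans Set.subset_union_left).trans hTsub)
      hLo.measurableSet.nullMeasurableSet hLfin, hμ, tsub_self]
  have hsub2 : f '' L ⊆ closure L := by
    by_contra hcon
    obtain ⟨x, hx, hx'⟩ := Set.not_subset.1 hcon
    have h1 := hpos (f '' L \ closure L) (hfLo.sdiff isClosed_closure) ⟨x, hx, hx'⟩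
    have h2 : μ (f '' L \ closure L) ≤ μ (f '' L \ L) :=
      measure_mono (Set.sdiff_subset_sdiff_right subset_closure)
    rw [hnull] at h2
    exact absurd h1 (not_lt.2 h2)
  have heq : f '' L = closure L := hsub2.antisymm (Set.subset_union_left.trans hTsub)
  have huniv : f '' L = Set.univ :=
    IsClopen.eq_univ ⟨heq ▸ isClosed_closure, hfLo⟩ ⟨p, hpf⟩
  obtain ⟨y, hy, hy'⟩ := (huniv ▸ Set.mem_univ (f c₀) : f c₀ ∈ f '' L)
  have := f.injective hy'
  subst this
  exact hLC hy hc₀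

/-- The embedding of the annulus into the punctured plane. -/
noncomputable def annEmb (z : AnnO) : ℂ := ((z.2 : ℝ) : ℂ) * (AddCircle.toCircle z.1 : ℂ)

theorem annEmb_continuous : Continuous annEmb := by
  unfold annEmb
  have h := AddCircle.continuous_toCircle (T := (1 : ℝ))
  fun_prop

theorem annEmb_norm (z : AnnO) : ‖annEmb z‖ = (z.2 : ℝ) := by
  unfold annEmb
  rw [norm_mul, Complex.norm_real, Real.norm_eq_abs, abs_of_pos z.2.2.1]
  have h : ‖((AddCircle.toCircle z.1 : Circle) : ℂ)‖ = 1 := Circle.norm_coe _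
  rw [h, mul_one]

theorem annEmb_ne (z : AnnO) : annEmb z ≠ 0 := by
  rw [← norm_pos_iff, annEmb_norm]
  exact z.2.2.1

theorem annEmb_injective : Function.Injective annEmb := by
  intro z w h
  have h2 : (z.2 : ℝ) = w.2 := by rw [← annEmb_norm, ← annEmb_norm, h]
  have h0 : ((w.2 : ℝ) : ℂ) ≠ 0 := by exact_mod_cast w.2.2.1.ne'
  unfold annEmb at h
  rw [h2] at h
  have h1 := mul_left_cancel₀ h0 h
  exact Prod.ext (AddCircle.injective_toCircle one_ne_zero (Subtype.ext h1)) (Subtype.ext h2)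

/-- A homotopy of maps into the punctured plane from a nonvanishing family. -/
theorem homotopic_of_family {Y : Type*} [TopologicalSpace Y] (F : unitInterval × Y → ℂ)
    (hF : Continuous F) (h0 : ∀ z, F z ≠ 0) (u v : C(Y, {z : ℂ // z ≠ 0}))
    (hu : ∀ y, F (0, y) = u y) (hv : ∀ y, F (1, y) = v y) : ContinuousMap.Homotopic u v :=
  ⟨{ toFun := fun z => ⟨F z, h0 z⟩
     continuous_toFun := by fun_prop
     map_zero_left := fun y => Subtype.ext (hu y)
     map_one_left := fun y => Subtype.ext (hv y) }⟩

/-- Radial projection of the punctured plane to the circle `ℝ/ℤ`. -/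
noncomputable def radial : C({z : ℂ // z ≠ 0}, Circle1) :=
  ⟨fun z => (AddCircle.homeomorphCircle (T := (1 : ℝ)) one_ne_zero).symm
      ⟨(z : ℂ) / (‖(z : ℂ)‖ : ℂ), by
        have := norm_ne_zero_iff.2 z.2
        exact mem_sphere_zero_iff_norm.2 (by simp [this])⟩, by
    refine (Homeomorph.continuous _).comp (Continuous.subtype_mk ?_ _)
    refine Continuous.div (by fun_prop) (by fun_prop) fun z => ?_
    exact_mod_cast norm_ne_zero_iff.2 z.2⟩

theorem radial_annEmb (z : AnnO) : radial ⟨annEmb z, annEmb_ne z⟩ = z.1 := by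
  refine (Homeomorph.symm_apply_eq _).2 ?_
  refine Eq.trans ?_ (AddCircle.homeomorphCircle_apply one_ne_zero z.1).symm
  apply Subtype.ext
  have h0 : ((z.2 : ℝ) : ℂ) ≠ 0 := by exact_mod_cast z.2.2.1.ne'
  change annEmb z / ((‖annEmb z‖ : ℝ) : ℂ) = _
  rw [annEmb_norm, div_eq_iff h0, mul_comm]
  rfl

/-- A loop in the annulus disjoint from a path joining a point below it to a point above it is
null-homotopic. -/
theorem nullhomotopic_of_path (γ : C(Circle1, AnnO)) (p q : AnnO) (σ : Path p q)
    (hσ : ∀ t s, γ s ≠ σ t) (hp : ∀ s, (p.2 : ℝ) < (γ s).2) (hq : ∀ s, ((γ s).2 : ℝ) < q.2) :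
    ∃ c : AnnO, ContinuousMap.Homotopic γ (ContinuousMap.const Circle1 c) := by
  have hE := annEmb_continuous
  let u0 : C(Circle1, {z : ℂ // z ≠ 0}) := ⟨fun s => ⟨annEmb (γ s), annEmb_ne _⟩, by fun_prop⟩
  have hup : ∀ s, annEmb (γ s) - annEmb p ≠ 0 := fun s h => by
    have := hσ 0 s
    rw [σ.source] at this
    exact this (annEmb_injective (sub_eq_zero.1 h))
  have huq : ∀ s, annEmb (γ s) - annEmb q ≠ 0 := fun s h => by
    have := hσ 1 s
    rw [σ.target] at this
    exact this (annEmb_injective (sub_eq_zero.1 h))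
  let u1 : C(Circle1, {z : ℂ // z ≠ 0}) := ⟨fun s => ⟨annEmb (γ s) - annEmb p, hup s⟩, by fun_prop⟩
  let u2 : C(Circle1, {z : ℂ // z ≠ 0}) := ⟨fun s => ⟨annEmb (γ s) - annEmb q, huq s⟩, by fun_prop⟩
  let w : {z : ℂ // z ≠ 0} := ⟨- annEmb q, neg_ne_zero.2 (annEmb_ne q)⟩
  have h01 : ContinuousMap.Homotopic u0 u1 := by
    refine homotopic_of_family (fun z => annEmb (γ z.2) - ((z.1 : ℝ) : ℂ) * annEmb p)
      (by fun_prop) ?_ _ _ (fun y => by simp [u0]) (fun y => by simp [u1])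
    rintro ⟨t, s⟩ h
    have h' := congrArg norm (sub_eq_zero.1 h)
    simp only [norm_mul, annEmb_norm, Complex.norm_real, Real.norm_eq_abs,
      abs_of_nonneg t.2.1] at h'
    have := hp s
    have h1 := t.2.2
    have h2 := p.2.2.1
    nlinarith
  have h12 : ContinuousMap.Homotopic u1 u2 := by
    refine homotopic_of_family (fun z => annEmb (γ z.2) - annEmb (σ z.1))
      (by fun_prop) ?_ _ _ (fun y => by simp [u1]) (fun y => by simp [u2])
    rintro ⟨t, s⟩ h
    exact hσ t s (annEmb_injective (sub_eq_zero.1 h))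
  have h23 : ContinuousMap.Homotopic (ContinuousMap.const Circle1 w) u2 := by
    refine homotopic_of_family (fun z => ((z.1 : ℝ) : ℂ) * annEmb (γ z.2) - annEmb q)
      (by fun_prop) ?_ _ _ (fun y => by simp [w]) (fun y => by simp [u2])
    rintro ⟨t, s⟩ h
    have h' := congrArg norm (sub_eq_zero.1 h)
    simp only [norm_mul, annEmb_norm, Complex.norm_real, Real.norm_eq_abs,
      abs_of_nonneg t.2.1] at h'
    have := hq s
    have h1 := t.2.2
    have h2 := (γ s).2.2.1
    nlinarith
  have h03 : ContinuousMap.Homotopic u0 (ContinuousMap.const Circle1 w) :=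
    (h01.trans h12).trans h23.symm
  have hfst : ContinuousMap.Homotopic (radial.comp u0)
      (radial.comp (ContinuousMap.const Circle1 w)) := (ContinuousMap.Homotopic.refl _).comp h03
  have : ContractibleSpace ↥(Set.Ioo (0 : ℝ) 1) :=
    (convex_Ioo 0 1).contractibleSpace ⟨1 / 2, by norm_num, by norm_num⟩
  obtain ⟨y, hy⟩ := id_nullhomotopic ↥(Set.Ioo (0 : ℝ) 1)
  have hsnd := hy.comp (ContinuousMap.Homotopic.refl (ContinuousMap.snd.comp γ))
  refine ⟨(radial w, y), ?_⟩
  have := hfst.prodMk hsnd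
  have e : γ = (radial.comp u0).prodMk
      ((ContinuousMap.id ↥(Set.Ioo (0 : ℝ) 1)).comp (ContinuousMap.snd.comp γ)) := by
    ext1 s
    exact Prod.ext (radial_annEmb (γ s)).symm rfl
  rw [← e] at this
  exact this

/-- An area-preserving homeomorphism of the open annulus isotopic to the
identity satisfies the intersection property: every essential simple closed
curve (image of an injective continuous non-null-homotopic loop) meets its
image under `f`. -/
theorem area_preserving_intersection_property (f : AnnO ≃ₜ AnnO)
    (hiso : IsotopicToIdO f) (harea : PreservesFiniteAreaO f) :
    ∀ γ : C(Circle1, AnnO), Function.Injective γ →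
      (¬ ∃ c : AnnO, ContinuousMap.Homotopic γ (ContinuousMap.const Circle1 c)) →
      (Set.range γ ∩ (⇑f) '' (Set.range γ)).Nonempty := by
  intro γ _ hess
  by_contra hcon
  have hd : ∀ c ∈ Set.range γ, f c ∉ Set.range γ := fun c hc h =>
    hcon ⟨f c, h, c, hc, rfl⟩
  obtain ⟨H, hH, hH0, hH1, hg⟩ := hiso
  obtain ⟨μ, hfin, -, hpos, hf⟩ := harea
  have : LocallyCompactSpace ↥(Set.Ioo (0 : ℝ) 1) := isOpen_Ioo.locallyCompactSpace
  have : LocallyPathConnectedSpace ↥(Set.Ioo (0 : ℝ) 1) := isOpen_Ioo.locallyPathConnectedSpace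
  have : LocallyPathConnectedSpace Circle1 :=
    (isQuotientMap_quotient_mk' : Topology.IsQuotientMap
      (Quotient.mk (QuotientAddGroup.leftRel (AddSubgroup.zmultiples (1 : ℝ))))).locallyPathConnectedSpace
  have : PreconnectedSpace ↥(Set.Ioo (0 : ℝ) 1) :=
    Subtype.preconnectedSpace isPreconnected_Ioo
  have hC : IsCompact (Set.range γ) := isCompact_range γ.continuous
  have hCc : IsConnected (Set.range γ) := isConnected_range γ.continuous
  -- uniform bounds for the heights along the isotopy
  have hcont : Continuous fun w : ↥(Set.Icc (0 : ℝ) 1) × Circle1 => ((H (w.1, γ w.2)).2 : ℝ) := by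
    fun_prop
  have : Nonempty ↥(Set.Icc (0 : ℝ) 1) := ⟨⟨0, by norm_num⟩⟩
  obtain ⟨m, -, hm⟩ := isCompact_univ.exists_isMinOn Set.univ_nonempty hcont.continuousOn
  obtain ⟨M, -, hM⟩ := isCompact_univ.exists_isMaxOn Set.univ_nonempty hcont.continuousOn
  obtain ⟨lo, hlo0, hlo1⟩ := exists_between (H (m.1, γ m.2)).2.2.1
  obtain ⟨hi, hhi0, hhi1⟩ := exists_between (H (M.1, γ M.2)).2.2.2
  let p : AnnO := (0, ⟨lo, hlo0, hlo1.trans (H (m.1, γ m.2)).2.2.2⟩)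
  let q : AnnO := (0, ⟨hi, (H (M.1, γ M.2)).2.2.1.trans hhi0, hhi1⟩)
  have hpb : ∀ t s, (p.2 : ℝ) < (H (t, γ s)).2 := fun t s =>
    hlo1.trans_le (hm (Set.mem_univ (t, s)))
  have hqb : ∀ t s, ((H (t, γ s)).2 : ℝ) < q.2 := fun t s =>
    (hM (Set.mem_univ (t, s))).trans_lt hhi0
  have hpt : ∀ t, ∀ c ∈ Set.range γ, H (t, c) ≠ p := by
    rintro t _ ⟨s, rfl⟩ h
    exact absurd (hpb t s) (by rw [h]; exact lt_irrefl _)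
  have hqt : ∀ t, ∀ c ∈ Set.range γ, H (t, c) ≠ q := by
    rintro t _ ⟨s, rfl⟩ h
    exact absurd (hqb t s) (by rw [h]; exact lt_irrefl _)
  have key := fun (x : AnnO) (hx : ∀ t, ∀ c ∈ Set.range γ, H (t, c) ≠ x) =>
    area_argument H hH hg _ _ hH0 f hH1 μ hfin hpos hf (Set.range γ) hC hCc x hx hd
  have hp1 : ∃ c ∈ Set.range γ, f c ∈ connectedComponentIn (Set.range γ)ᶜ p := by
    by_contra h
    push Not at h
    exact key p hpt h
  have hq1 : ∃ c ∈ Set.range γ, f c ∈ connectedComponentIn (Set.range γ)ᶜ q := by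
    by_contra h
    push Not at h
    exact key q hqt h
  obtain ⟨c, hc, hcp⟩ := hp1
  obtain ⟨c', hc', hcq⟩ := hq1
  have hfC : IsPreconnected (f '' Set.range γ) :=
    hCc.isPreconnected.image _ f.continuous.continuousOn
  have hfCs : f '' Set.range γ ⊆ (Set.range γ)ᶜ := by
    rintro _ ⟨x, hx, rfl⟩
    exact hd x hx
  have hsub := hfC.subset_connectedComponentIn ⟨c, hc, rfl⟩ hfCs
  have e1 := connectedComponentIn_eq hcp
  have e2 := connectedComponentIn_eq hcq
  have e3 := connectedComponentIn_eq (hsub ⟨c', hc', rfl⟩)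
  have hpq : connectedComponentIn (Set.range γ)ᶜ p = connectedComponentIn (Set.range γ)ᶜ q := by
    rw [e1, e2, e3]
  have hpc : p ∈ (Set.range γ)ᶜ := fun h => hpt _ p h (hH0 p)
  have hqc : q ∈ (Set.range γ)ᶜ := fun h => hqt _ q h (hH0 q)
  have hLo : IsOpen (connectedComponentIn (Set.range γ)ᶜ p) :=
    hC.isClosed.isOpen_compl.connectedComponentIn
  have hpath := hLo.isConnected_iff_isPathConnected.1 (isConnected_connectedComponentIn_iff.2 hpc)
  obtain ⟨σ, hσ⟩ := hpath.joinedIn p (mem_connectedComponentIn hpc) q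
    (hpq ▸ mem_connectedComponentIn hqc)
  refine hess (nullhomotopic_of_path γ p q σ ?_ ?_ ?_)
  · intro t s h
    exact connectedComponentIn_subset _ _ (hσ t) ⟨s, h⟩
  · intro s
    have := hpb ⟨0, by norm_num⟩ s
    rwa [hH0] at this
  · intro s
    have := hqb ⟨0, by norm_num⟩ s
    rwa [hH0] at this
end
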